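/- arXiv:1204.5684 — 3 statements merged into one kernel-verified Lean document; each statement's English description precedes it below -/
import Mathlib

section
/- Let n ≥ 2 be an integer and α₁, α₂, λ real numbers with 0 < α₁ < n, 0 < α₂ < n, λ > 0, α₁ + λ > n-1, α₂ + λ > n-1, α₁ + α₂ < 2n-1, and 2n-2 < α₁ + α₂ + λ < 3n-2; set σ = 2 + α₁ + α₂ + λ - 2n. For x, w ∈ ℝⁿ define β(x,w) = 4|x|²(1+|w-x|²)/(1+|w-x|²+|x|²)², J(x,w) = ∫₀¹ u^{(λ+α₂-n+1)/2 - 1} (1-u)^{(n-3)/2} (1-β(x,w)u)^{-α₂/2} du, and D(w) = |w|^σ ∫_{ℝⁿ} |x|^{λ+α₂-n} |x-w|^{-α₁} (1+|x-w|²+|x|²)^{n-1-λ-α₂} J(x,w) dx. Then sup_{w ∈ ℝⁿ} D(w) < ∞. -/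
open MeasureTheory Real

/-- Dyadic decomposition: powers of the distance over sets covered by dyadic annuli. -/
lemma lintegral_dist_rpow_le {X : Type*} [PseudoMetricSpace X] [MeasurableSpace X]
    [OpensMeasurableSpace X] (a d q M : ℝ) (hq : 0 < q) (hqd : q ^ (a + d) < 1) (hM : 0 ≤ M) :
    ∃ C : ℝ, 0 ≤ C ∧ ∀ (μ : Measure X) (c : X),
      (∀ ρ : ℝ, 0 < ρ → μ (Metric.closedBall c ρ) ≤ ENNReal.ofReal (M * ρ ^ d)) →
      ∀ (R : ℝ) (E : Set X), 0 < R →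
        (∀ x ∈ E, ∃ k : ℕ, q ^ k * R / 2 ≤ dist x c ∧ dist x c ≤ q ^ k * R * 2) →
        ∫⁻ x in E, ENNReal.ofReal (dist x c ^ a) ∂μ ≤ ENNReal.ofReal (C * R ^ (a + d)) := by
  refine ⟨2 ^ |a| * M * 2 ^ d * (1 - q ^ (a + d))⁻¹, ?_, ?_⟩
  · have : 0 ≤ 1 - q ^ (a + d) := by linarith
    positivity
  intro μ c hμ R E hR hE
  have hball : ∀ k : ℕ, MeasurableSet (Metric.closedBall c (q ^ k * R * 2)) :=
    fun k => Metric.isClosed_closedBall.measurableSet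
  set F : X → ENNReal := fun x => ∑' k : ℕ,
    (Metric.closedBall c (q ^ k * R * 2)).indicator
      (fun _ => ENNReal.ofReal (2 ^ |a| * (q ^ k * R) ^ a)) x with hF
  have hFm : ∀ k : ℕ, Measurable ((Metric.closedBall c (q ^ k * R * 2)).indicator
      (fun _ => ENNReal.ofReal (2 ^ |a| * (q ^ k * R) ^ a))) :=
    fun k => measurable_const.indicator (hball k)
  have hpt : ∀ x ∈ E, ENNReal.ofReal (dist x c ^ a) ≤ F x := by
    intro x hx
    obtain ⟨k, hk1, hk2⟩ := hE x hx
    refine le_trans ?_ (ENNReal.le_tsum k)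
    rw [Set.indicator_of_mem (by simpa using hk2)]
    apply ENNReal.ofReal_le_ofReal
    have hs : 0 < q ^ k * R := by positivity
    generalize q ^ k * R = s at *
    have hd : dist x c = (dist x c / s) * s := by field_simp
    have h1 : 1 / 2 ≤ dist x c / s := by rw [div_le_div_iff₀ (by norm_num) hs]; linarith
    have h2 : dist x c / s ≤ 2 := by rw [div_le_iff₀ hs]; linarith
    rw [hd, mul_rpow (by positivity) hs.le]
    apply mul_le_mul_of_nonneg_right _ (by positivity)
    generalize dist x c / s = u at *
    have hu : 0 < u := by linarith
    rcases le_total 0 a with ha | ha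
    · rw [abs_of_nonneg ha]
      exact rpow_le_rpow hu.le h2 ha
    · rw [abs_of_nonpos ha, rpow_neg (by norm_num), ← inv_rpow (by norm_num)]
      exact rpow_le_rpow_of_nonpos (by norm_num) (by linarith) ha
  calc ∫⁻ x in E, ENNReal.ofReal (dist x c ^ a) ∂μ
      ≤ ∫⁻ x in E, F x ∂μ := setLIntegral_mono (Measurable.tsum hFm) hpt
    _ ≤ ∫⁻ x, F x ∂μ := setLIntegral_le_lintegral _ _
    _ = ∑' k : ℕ, ENNReal.ofReal (2 ^ |a| * (q ^ k * R) ^ a) *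
          μ (Metric.closedBall c (q ^ k * R * 2)) := by
        rw [hF, lintegral_tsum (fun k => (hFm k).aemeasurable)]
        congr 1 with k
        rw [lintegral_indicator_const (hball k)]
    _ ≤ ∑' k : ℕ, ENNReal.ofReal
          (2 ^ |a| * M * 2 ^ d * R ^ (a + d) * (q ^ (a + d)) ^ k) := by
        refine ENNReal.tsum_le_tsum fun k => ?_
        refine (mul_le_mul_right (hμ _ (by positivity)) _).trans ?_
        rw [← ENNReal.ofReal_mul (by positivity)]
        apply le_of_eq
        congr 1
        rw [mul_rpow (by positivity) (by positivity), mul_rpow (by positivity) (by positivity),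
          mul_rpow (by positivity) (by positivity), ← rpow_natCast_mul hq.le,
          ← rpow_natCast_mul hq.le, rpow_add hR, ← rpow_mul_natCast hq.le,
          mul_comm (a + d) (k : ℝ), mul_add, rpow_add hq]
        ring
    _ = ENNReal.ofReal (2 ^ |a| * M * 2 ^ d * (1 - q ^ (a + d))⁻¹ * R ^ (a + d)) := by
        have hs := summable_geometric_of_lt_one (by positivity) hqd
        rw [← ENNReal.ofReal_tsum_of_nonneg (fun k => by positivity) (hs.mul_left _),
          tsum_mul_left, tsum_geometric_of_lt_one (by positivity) hqd]
        congr 1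
        ring

lemma lintegral_closedBall_rpow_le {X : Type*} [PseudoMetricSpace X] [MeasurableSpace X]
    [OpensMeasurableSpace X] (a d M : ℝ) (had : 0 < a + d) (hM : 0 ≤ M) :
    ∃ C : ℝ, 0 ≤ C ∧ ∀ (μ : Measure X) (c : X),
      (∀ ρ : ℝ, 0 < ρ → μ (Metric.closedBall c ρ) ≤ ENNReal.ofReal (M * ρ ^ d)) →
      ∀ R : ℝ, 0 < R → ∫⁻ x in {x | 0 < dist x c ∧ dist x c ≤ R},
        ENNReal.ofReal (dist x c ^ a) ∂μ ≤ ENNReal.ofReal (C * R ^ (a + d)) := by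
  obtain ⟨C, hC, h⟩ := lintegral_dist_rpow_le (X := X) a d (1 / 2) M (by norm_num)
    (rpow_lt_one (by norm_num) (by norm_num) had) hM
  refine ⟨C, hC, fun μ c hμ R hR => h μ c hμ R _ hR fun x hx => ?_⟩
  obtain ⟨k, hk1, hk2⟩ := exists_nat_pow_near_of_lt_one (x := dist x c / R)
    (div_pos hx.1 hR) ((div_le_one hR).2 hx.2) (y := (1 / 2 : ℝ)) (by norm_num) (by norm_num)
  rw [lt_div_iff₀ hR, pow_succ] at hk1
  rw [div_le_iff₀ hR] at hk2
  have := dist_nonneg (x := x) (y := c)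
  exact ⟨k, by linarith, by linarith⟩

lemma lintegral_compl_ball_rpow_le {X : Type*} [PseudoMetricSpace X] [MeasurableSpace X]
    [OpensMeasurableSpace X] (a d M : ℝ) (had : a + d < 0) (hM : 0 ≤ M) :
    ∃ C : ℝ, 0 ≤ C ∧ ∀ (μ : Measure X) (c : X),
      (∀ ρ : ℝ, 0 < ρ → μ (Metric.closedBall c ρ) ≤ ENNReal.ofReal (M * ρ ^ d)) →
      ∀ R : ℝ, 0 < R → ∫⁻ x in {x | R ≤ dist x c},
        ENNReal.ofReal (dist x c ^ a) ∂μ ≤ ENNReal.ofReal (C * R ^ (a + d)) := by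
  obtain ⟨C, hC, h⟩ := lintegral_dist_rpow_le (X := X) a d 2 M (by norm_num)
    (rpow_lt_one_of_one_lt_of_neg (by norm_num) had) hM
  refine ⟨C, hC, fun μ c hμ R hR => h μ c hμ R _ hR fun x hx => ?_⟩
  obtain ⟨k, hk1, hk2⟩ := exists_nat_pow_near (x := dist x c / R)
    ((one_le_div hR).2 hx) (y := (2 : ℝ)) (by norm_num)
  rw [le_div_iff₀ hR] at hk1
  rw [div_lt_iff₀ hR, pow_succ] at hk2
  have := dist_nonneg (x := x) (y := c)
  exact ⟨k, by linarith, by linarith⟩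

lemma lintegral_closedBall_abs_sub_rpow_le (ε : ℝ) (hε0 : 0 < ε) (hε1 : ε < 1) :
    ∃ C : ℝ, 0 ≤ C ∧ ∀ t c ρ : ℝ, 0 < ρ →
      ∫⁻ s in Metric.closedBall c ρ, ENNReal.ofReal (|t - s| ^ (-ε)) ≤
        ENNReal.ofReal (C * ρ ^ (1 - ε)) := by
  obtain ⟨C, hC, h⟩ := lintegral_closedBall_rpow_le (X := ℝ) (-ε) 1 2 (by linarith) (by norm_num)
  refine ⟨C + 2, by linarith, fun t c ρ hρ => ?_⟩
  have hvol : ∀ (c ρ : ℝ), 0 < ρ → volume (Metric.closedBall c ρ) ≤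
      ENNReal.ofReal (2 * ρ ^ (1:ℝ)) := by
    intro c ρ _
    rw [Real.volume_closedBall, rpow_one]
  have h1 := h volume t (hvol t) ρ hρ
  set A := {x : ℝ | 0 < dist x t ∧ dist x t ≤ ρ} with hA
  have hAm : MeasurableSet A := by
    apply MeasurableSet.inter
    · exact measurableSet_lt measurable_const (measurable_id.dist measurable_const)
    · exact measurableSet_le (measurable_id.dist measurable_const) measurable_const
  have hpt : ∀ s, ENNReal.ofReal (|t - s| ^ (-ε)) ≤
      A.indicator (fun x => ENNReal.ofReal (dist x t ^ (-ε))) s + ENNReal.ofReal (ρ ^ (-ε)) := by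
    intro s
    have hd : |t - s| = dist s t := by rw [Real.dist_eq, abs_sub_comm]
    rw [hd]
    by_cases hs : s ∈ A
    · rw [Set.indicator_of_mem hs]; exact le_self_add
    · rw [Set.indicator_of_notMem hs, zero_add]
      apply ENNReal.ofReal_le_ofReal
      rcases (dist_nonneg (x := s) (y := t)).eq_or_lt with h0 | h0
      · rw [← h0, zero_rpow (by linarith)]; positivity
      · have : ρ < dist s t := by
          by_contra hcon
          exact hs ⟨h0, not_lt.1 hcon⟩
        exact rpow_le_rpow_of_nonpos hρ this.le (by linarith)
  calc ∫⁻ s in Metric.closedBall c ρ, ENNReal.ofReal (|t - s| ^ (-ε))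
      ≤ ∫⁻ s in Metric.closedBall c ρ,
        (A.indicator (fun x => ENNReal.ofReal (dist x t ^ (-ε))) s + ENNReal.ofReal (ρ ^ (-ε))) :=
        lintegral_mono hpt
    _ = (∫⁻ s in Metric.closedBall c ρ, A.indicator (fun x => ENNReal.ofReal (dist x t ^ (-ε))) s)
        + ENNReal.ofReal (ρ ^ (-ε)) * volume (Metric.closedBall c ρ) := by
        rw [lintegral_add_right _ measurable_const, setLIntegral_const]
    _ ≤ ENNReal.ofReal (C * ρ ^ (-ε + 1)) + ENNReal.ofReal (ρ ^ (-ε)) *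
          ENNReal.ofReal (2 * ρ ^ (1:ℝ)) := by
        gcongr
        · refine (setLIntegral_le_lintegral _ _).trans ?_
          rw [lintegral_indicator hAm]
          exact h1
        · exact hvol c ρ hρ
    _ = ENNReal.ofReal ((C + 2) * ρ ^ (1 - ε)) := by
        rw [← ENNReal.ofReal_mul (by positivity), ← ENNReal.ofReal_add (by positivity)
          (by positivity)]
        congr 1
        rw [show 1 - ε = -ε + 1 by ring, rpow_add hρ]
        ring

lemma lintegral_closedBall_hyperplane_le (m : ℕ) (ε : ℝ) (hε0 : 0 < ε) (hε1 : ε < 1) :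
    ∃ C : ℝ, 0 ≤ C ∧ ∀ (e : EuclideanSpace ℝ (Fin (m + 1))), ‖e‖ = 1 →
      ∀ (t : ℝ) (c : EuclideanSpace ℝ (Fin (m + 1))) (ρ : ℝ), 0 < ρ →
      ∫⁻ x in Metric.closedBall c ρ, ENNReal.ofReal (|t - inner ℝ e x| ^ (-ε)) ≤
        ENNReal.ofReal (C * ρ ^ ((m + 1 : ℝ) - ε)) := by
  obtain ⟨C, hC, h⟩ := lintegral_closedBall_abs_sub_rpow_le ε hε0 hε1
  refine ⟨C * 2 ^ m, by positivity, fun e he t c ρ hρ => ?_⟩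
  obtain ⟨b, hb⟩ := Orthonormal.exists_orthonormalBasis_extension_of_card_eq (𝕜 := ℝ)
    (E := EuclideanSpace ℝ (Fin (m + 1))) (ι := Fin (m + 1)) (by simp)
    (v := fun _ => e) (s := {0}) (by
      constructor
      · intro i; exact he
      · intro i j hij; exact absurd (Subsingleton.elim i j) hij)
  have hb0 : b 0 = e := hb 0 rfl
  let f : ℝ → ENNReal := (Metric.closedBall (inner ℝ (b 0) c) ρ).indicator
    (fun s => ENNReal.ofReal (|t - s| ^ (-ε)))
  let B : Set (Fin m → ℝ) := Set.pi Set.univ fun i => Metric.closedBall (inner ℝ (b i.succ) c) ρ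
  have hBm : MeasurableSet B :=
    MeasurableSet.univ_pi fun i => Metric.isClosed_closedBall.measurableSet
  let g : (Fin m → ℝ) → ENNReal := B.indicator 1
  have hf : Measurable f :=
    Measurable.indicator (by fun_prop) Metric.isClosed_closedBall.measurableSet
  have hg : Measurable g := measurable_one.indicator hBm
  let φ : EuclideanSpace ℝ (Fin (m + 1)) → ℝ × (Fin m → ℝ) := fun x =>
    (MeasurableEquiv.piFinSuccAbove (fun _ => ℝ) 0) (WithLp.ofLp (b.repr x))
  have hφ : MeasurePreserving φ volume volume :=
    (volume_preserving_piFinSuccAbove (fun _ : Fin (m + 1) => ℝ) 0).comp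
      ((PiLp.volume_preserving_ofLp _).comp b.measurePreserving_repr)
  have hφ1 : ∀ x, (φ x).1 = inner ℝ (b 0) x := fun x => b.repr_apply_apply x 0
  have hφ2 : ∀ x i, (φ x).2 i = inner ℝ (b i.succ) x := fun x i => b.repr_apply_apply x i.succ
  have hcoord : ∀ x ∈ Metric.closedBall c ρ, ∀ i,
      inner ℝ (b i) x ∈ Metric.closedBall (inner ℝ (b i) c) ρ := by
    intro x hx i
    rw [mem_closedBall_iff_norm] at hx ⊢
    rw [← inner_sub_right]
    refine (norm_inner_le_norm _ _).trans ?_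
    rwa [b.norm_eq_one, one_mul]
  calc ∫⁻ x in Metric.closedBall c ρ, ENNReal.ofReal (|t - inner ℝ e x| ^ (-ε))
      ≤ ∫⁻ x in Metric.closedBall c ρ, f (φ x).1 * g (φ x).2 := by
        refine setLIntegral_mono (by have := hφ.measurable; fun_prop) fun x hx => ?_
        have h1 : (φ x).1 ∈ Metric.closedBall (inner ℝ (b 0) c) ρ := by
          rw [hφ1]; exact hcoord x hx 0
        have h2 : (φ x).2 ∈ B := fun i _ => by
          rw [hφ2]; exact hcoord x hx i.succ
        simp only [f, g]
        rw [Set.indicator_of_mem h1, Set.indicator_of_mem h2, hφ1, hb0]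
        simp
    _ ≤ ∫⁻ x, f (φ x).1 * g (φ x).2 := setLIntegral_le_lintegral _ _
    _ = ∫⁻ p : ℝ × (Fin m → ℝ), f p.1 * g p.2 :=
        hφ.lintegral_comp (f := fun p : ℝ × (Fin m → ℝ) => f p.1 * g p.2) (by fun_prop)
    _ = (∫⁻ s, f s) * ∫⁻ z, g z := lintegral_prod_mul hf.aemeasurable hg.aemeasurable
    _ ≤ ENNReal.ofReal (C * ρ ^ (1 - ε)) * ENNReal.ofReal ((2 * ρ) ^ m) := by
        gcongr
        · simp only [f]
          rw [lintegral_indicator Metric.isClosed_closedBall.measurableSet]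
          exact h t _ ρ hρ
        · simp only [g]
          rw [lintegral_indicator_one hBm, volume_pi_pi]
          simp [Real.volume_closedBall, ENNReal.ofReal_pow, hρ.le]
    _ = ENNReal.ofReal (C * 2 ^ m * ρ ^ ((m + 1 : ℝ) - ε)) := by
        rw [← ENNReal.ofReal_mul (by positivity)]
        congr 1
        rw [show (m + 1 : ℝ) - ε = (1 - ε) + m by ring, rpow_add hρ, rpow_natCast]
        ring

lemma intervalIntegrable_rpow_mul_one_sub_rpow {p k : ℝ} (hp : -1 < p) (hk : -1 < k) :
    IntervalIntegrable (fun u : ℝ => u ^ p * (1 - u) ^ k) volume 0 1 := by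
  have h := (Complex.betaIntegral_convergent (u := ((p + 1 : ℝ) : ℂ)) (v := ((k + 1 : ℝ) : ℂ))
    (by rw [Complex.ofReal_re]; linarith) (by rw [Complex.ofReal_re]; linarith)).norm
  rw [intervalIntegrable_iff_integrableOn_Ioo_of_le zero_le_one] at h ⊢
  refine h.congr_fun (fun u hu => ?_) measurableSet_Ioo
  have h1 : (1 : ℂ) - (u : ℂ) = ((1 - u : ℝ) : ℂ) := by push_cast; rfl
  dsimp only
  rw [norm_mul, h1, Complex.norm_cpow_eq_rpow_re_of_pos hu.1,
    Complex.norm_cpow_eq_rpow_re_of_pos (by linarith [hu.2])]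
  simp

lemma abs_integral_rpow_one_sub_mul_le {p k α ε : ℝ} (hp : -1 < p) (hε : 0 ≤ ε) (hεα : ε ≤ α)
    (hk : -1 < k - (α - ε) / 2) :
    ∃ C : ℝ, 0 ≤ C ∧ ∀ β : ℝ, 0 ≤ β → β < 1 →
      |∫ u in (0:ℝ)..1, u ^ p * (1 - u) ^ k * (1 - β * u) ^ (-(α / 2))| ≤
        C * (1 - β) ^ (-(ε / 2)) := by
  have hint := intervalIntegrable_rpow_mul_one_sub_rpow hp hk
  refine ⟨∫ u in (0:ℝ)..1, u ^ p * (1 - u) ^ (k - (α - ε) / 2), ?_, fun β hβ0 hβ1 => ?_⟩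
  · refine intervalIntegral.integral_nonneg zero_le_one fun u hu => ?_
    have := sub_nonneg.2 hu.2
    have := hu.1
    positivity
  rw [← intervalIntegral.integral_mul_const, ← Real.norm_eq_abs]
  refine intervalIntegral.norm_integral_le_of_norm_le zero_le_one ?_ (hint.mul_const _)
  filter_upwards [Measure.ae_ne volume (1 : ℝ)] with u hu1 hu
  have hu0 : 0 < u := hu.1
  have h1u : 0 < 1 - u := sub_pos.2 (lt_of_le_of_ne hu.2 hu1)
  have hβu1 : 1 - u ≤ 1 - β * u := by nlinarith
  have hβu2 : 1 - β ≤ 1 - β * u := by nlinarith [hu.2]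
  have hβu : 0 < 1 - β * u := by linarith
  have hβ : 0 < 1 - β := by linarith
  rw [Real.norm_of_nonneg (by positivity), mul_assoc, mul_assoc]
  refine mul_le_mul_of_nonneg_left ?_ (by positivity)
  calc (1 - u) ^ k * (1 - β * u) ^ (-(α / 2))
      = (1 - u) ^ k * ((1 - β * u) ^ (-((α - ε) / 2)) * (1 - β * u) ^ (-(ε / 2))) := by
        rw [← rpow_add hβu]; congr 2; ring
    _ ≤ (1 - u) ^ k * ((1 - u) ^ (-((α - ε) / 2)) * (1 - β) ^ (-(ε / 2))) := by
        refine mul_le_mul_of_nonneg_left ?_ (by positivity)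
        exact mul_le_mul (rpow_le_rpow_of_nonpos h1u hβu1 (by linarith))
          (rpow_le_rpow_of_nonpos hβ hβu2 (by linarith)) (by positivity) (by positivity)
    _ = (1 - u) ^ (k - (α - ε) / 2) * (1 - β) ^ (-(ε / 2)) := by
        rw [← mul_assoc, ← rpow_add h1u]; rfl

/-- The three regions: near `0`, near `w`, and away from both. -/
lemma rpow_mul_rpow_mul_rpow_le {A α B r a b : ℝ} (hα : 0 ≤ α) (hB : B ≤ 0) (hr : 0 < r)
    (ha : 0 < a) (hb : 0 < b) (hab : r ≤ a + b) (hab' : a ≤ b + r) :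
    (a ≤ r / 2 ∧ a ^ A * b ^ (-α) * (1 + b ^ 2 + a ^ 2) ^ B
        ≤ 4 ^ (|A| + α - B) * r ^ (2 * B - α) * a ^ A) ∨
    (b ≤ r / 2 ∧ a ^ A * b ^ (-α) * (1 + b ^ 2 + a ^ 2) ^ B
        ≤ 4 ^ (|A| + α - B) * r ^ (2 * B + A) * b ^ (-α)) ∨
    (r / 2 ≤ a ∧ a ^ A * b ^ (-α) * (1 + b ^ 2 + a ^ 2) ^ B
        ≤ 4 ^ (|A| + α - B) * a ^ (A + 2 * B - α)) := by
  have h4 : ∀ x y : ℝ, x ≤ y → (4 : ℝ) ^ x ≤ 4 ^ y := fun x y h =>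
    rpow_le_rpow_of_exponent_le (by norm_num) h
  have hA := abs_nonneg A
  have quarter : ∀ (x y e : ℝ), 0 < x → x / 4 ≤ y → e ≤ 0 → y ^ e ≤ 4 ^ (-e) * x ^ e := by
    intro x y e hx hxy he
    refine (rpow_le_rpow_of_nonpos (by positivity) hxy he).trans (le_of_eq ?_)
    rw [div_rpow hx.le (by norm_num), rpow_neg (by norm_num)]
    field_simp
  have sq_rpow : ∀ x : ℝ, 0 < x → (x ^ 2) ^ B = x ^ (2 * B) := by
    intro x hx
    rw [← rpow_natCast, ← rpow_mul hx.le]; norm_num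
  by_cases h1 : a ≤ r / 2
  · left
    refine ⟨h1, ?_⟩
    have hb' := quarter r b (-α) hr (by linarith) (by linarith)
    have hS := quarter (r ^ 2) (1 + b ^ 2 + a ^ 2) B (by positivity) (by nlinarith) hB
    rw [sq_rpow r hr] at hS
    calc a ^ A * b ^ (-α) * (1 + b ^ 2 + a ^ 2) ^ B
        ≤ a ^ A * (4 ^ (-(-α)) * r ^ (-α)) * (4 ^ (-B) * r ^ (2 * B)) := by gcongr
      _ = 4 ^ (α - B) * r ^ (2 * B - α) * a ^ A := by
        rw [show α - B = -(-α) + -B by ring, show 2 * B - α = -α + 2 * B by ring,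
          rpow_add (by norm_num), rpow_add hr]; ring
      _ ≤ _ := by gcongr ?_ * _ * _; exact h4 _ _ (by linarith)
  · push Not at h1
    right
    by_cases h2 : b ≤ r / 2
    · left
      refine ⟨h2, ?_⟩
      have hA' : a ^ A ≤ 4 ^ |A| * r ^ A := by
        rcases le_total 0 A with h | h
        · rw [abs_of_nonneg h, ← mul_rpow (by norm_num) hr.le]
          exact rpow_le_rpow ha.le (by linarith) h
        · rw [abs_of_nonpos h]
          exact quarter r a A hr (by linarith) h
      have hS := quarter (r ^ 2) (1 + b ^ 2 + a ^ 2) B (by positivity) (by nlinarith) hB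
      rw [sq_rpow r hr] at hS
      calc a ^ A * b ^ (-α) * (1 + b ^ 2 + a ^ 2) ^ B
          ≤ (4 ^ |A| * r ^ A) * b ^ (-α) * (4 ^ (-B) * r ^ (2 * B)) := by gcongr
        _ = 4 ^ (|A| - B) * r ^ (2 * B + A) * b ^ (-α) := by
          rw [show |A| - B = |A| + -B by ring, rpow_add (by norm_num), rpow_add hr]; ring
        _ ≤ _ := by gcongr ?_ * _ * _; exact h4 _ _ (by linarith)
    · push Not at h2
      right
      refine ⟨h1.le, ?_⟩
      have hb' := quarter a b (-α) ha (by linarith) (by linarith)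
      have hS : (1 + b ^ 2 + a ^ 2) ^ B ≤ (a ^ 2) ^ B :=
        rpow_le_rpow_of_nonpos (by positivity) (by nlinarith) hB
      rw [sq_rpow a ha] at hS
      calc a ^ A * b ^ (-α) * (1 + b ^ 2 + a ^ 2) ^ B
          ≤ a ^ A * (4 ^ (-(-α)) * a ^ (-α)) * a ^ (2 * B) := by gcongr
        _ = 4 ^ α * a ^ (A + 2 * B - α) := by
          rw [show A + 2 * B - α = A + -α + 2 * B by ring, rpow_add ha, rpow_add ha, neg_neg]; ring
        _ ≤ _ := by gcongr ?_ * _; exact h4 _ _ (by linarith)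

lemma ae_inner_ne {E : Type*} [NormedAddCommGroup E] [InnerProductSpace ℝ E]
    [FiniteDimensional ℝ E] [MeasurableSpace E] [BorelSpace E] {e : E} (he : e ≠ 0) (t : ℝ) :
    ∀ᵐ x : E, inner ℝ e x ≠ t := by
  let s : AffineSubspace ℝ E := (AffineSubspace.mk' t ⊥).comap (innerₛₗ ℝ e).toAffineMap
  have hs : ∀ x, x ∈ s ↔ inner ℝ e x = t := by
    intro x
    simp [s, AffineSubspace.mem_comap, AffineSubspace.mem_mk', sub_eq_zero]
  have hne : s ≠ ⊤ := by
    intro h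
    have h0 : inner ℝ e (0 : E) = t := (hs 0).1 (h ▸ AffineSubspace.mem_top ℝ E 0)
    have h1 : inner ℝ e e = t := (hs e).1 (h ▸ AffineSubspace.mem_top ℝ E e)
    rw [inner_zero_right] at h0
    rw [← h0] at h1
    exact he (inner_self_eq_zero.1 h1)
  have h := Measure.addHaar_affineSubspace (volume : Measure E) s hne
  rw [ae_iff]
  convert h using 2
  ext x
  simp [hs]

lemma lintegral_hyperplane_weight_le (m : ℕ) {A α B ε d : ℝ} (hε0 : 0 < ε) (hε1 : ε < 1)
    (hα : 0 ≤ α) (hB : B ≤ 0) (hd : d = (m + 1 : ℝ) - ε) (hA : 0 < A + d) (hαd : 0 < -α + d)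
    (hABd : A + 2 * B - α + d < 0) :
    ∃ C : ℝ, 0 ≤ C ∧ ∀ e w : EuclideanSpace ℝ (Fin (m + 1)), ‖e‖ = 1 → w ≠ 0 → ∀ t : ℝ,
      ∫⁻ x, ENNReal.ofReal (‖x‖ ^ A * ‖x - w‖ ^ (-α) * (1 + ‖x - w‖ ^ 2 + ‖x‖ ^ 2) ^ B *
        |t - inner ℝ e x| ^ (-ε)) ≤ ENNReal.ofReal (C * ‖w‖ ^ (A + 2 * B - α + d)) := by
  obtain ⟨M, hM, hMb⟩ := lintegral_closedBall_hyperplane_le m ε hε0 hε1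
  obtain ⟨C₁, hC₁, h₁⟩ := lintegral_closedBall_rpow_le
    (X := EuclideanSpace ℝ (Fin (m + 1))) A d M hA hM
  obtain ⟨C₂, hC₂, h₂⟩ := lintegral_closedBall_rpow_le
    (X := EuclideanSpace ℝ (Fin (m + 1))) (-α) d M hαd hM
  obtain ⟨C₃, hC₃, h₃⟩ := lintegral_compl_ball_rpow_le
    (X := EuclideanSpace ℝ (Fin (m + 1))) (A + 2 * B - α) d M hABd hM
  set Q : ℝ := 4 ^ (|A| + α - B) with hQ
  have hQ0 : 0 ≤ Q := by positivity
  refine ⟨Q * (C₁ * (1 / 2) ^ (A + d) + C₂ * (1 / 2) ^ (-α + d) +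
    C₃ * (1 / 2) ^ (A + 2 * B - α + d)), by positivity, fun e w he hw t => ?_⟩
  have hr : 0 < ‖w‖ := norm_pos_iff.2 hw
  set r := ‖w‖ with hr_def
  set H : EuclideanSpace ℝ (Fin (m + 1)) → ENNReal :=
    fun x => ENNReal.ofReal (|t - inner ℝ e x| ^ (-ε)) with hH
  have hHm : Measurable H := by fun_prop
  set μ := (volume : Measure (EuclideanSpace ℝ (Fin (m + 1)))).withDensity H with hμ
  have hball : ∀ (c : EuclideanSpace ℝ (Fin (m + 1))) (ρ : ℝ), 0 < ρ →
      μ (Metric.closedBall c ρ) ≤ ENNReal.ofReal (M * ρ ^ d) := by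
    intro c ρ hρ
    rw [hμ, withDensity_apply _ Metric.isClosed_closedBall.measurableSet, hd]
    exact hMb e he t c ρ hρ
  have hdist : ∀ c : EuclideanSpace ℝ (Fin (m + 1)), Measurable fun x => dist x c :=
    fun c => measurable_id.dist measurable_const
  have hEm : ∀ (c : EuclideanSpace ℝ (Fin (m + 1))) (R : ℝ),
      MeasurableSet {x | 0 < dist x c ∧ dist x c ≤ R} := fun c R =>
    (measurableSet_lt measurable_const (hdist c)).inter
      (measurableSet_le (hdist c) measurable_const)
  have hEm' : MeasurableSet {x : EuclideanSpace ℝ (Fin (m + 1)) | r / 2 ≤ dist x 0} :=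
    measurableSet_le measurable_const (hdist 0)
  have hmeas : ∀ (k a : ℝ) (c : EuclideanSpace ℝ (Fin (m + 1))),
      Measurable fun x => ENNReal.ofReal k * (H x * ENNReal.ofReal (dist x c ^ a)) := by
    intro k a c
    have := hdist c
    fun_prop
  have hreg : ∀ (E : Set (EuclideanSpace ℝ (Fin (m + 1)))) (k a b : ℝ)
      (c : EuclideanSpace ℝ (Fin (m + 1))), 0 ≤ k → MeasurableSet E →
      ∫⁻ x in E, ENNReal.ofReal (dist x c ^ a) ∂μ ≤ ENNReal.ofReal b →
      ∫⁻ x, E.indicator (fun x => ENNReal.ofReal k * (H x * ENNReal.ofReal (dist x c ^ a))) x ≤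
        ENNReal.ofReal (k * b) := by
    intro E k a b c hk hE hb
    have := hdist c
    rw [lintegral_indicator hE, lintegral_const_mul _ (by fun_prop), ENNReal.ofReal_mul hk]
    rw [hμ, setLIntegral_withDensity_eq_setLIntegral_mul _ hHm (by fun_prop) hE] at hb
    exact mul_le_mul_right hb _
  have hr2 : 0 < r / 2 := by positivity
  have i₁ := hreg _ (Q * r ^ (2 * B - α)) A _ 0 (by positivity) (hEm 0 (r / 2))
    (h₁ μ 0 (hball 0) (r / 2) hr2)
  have i₂ := hreg _ (Q * r ^ (2 * B + A)) (-α) _ w (by positivity) (hEm w (r / 2))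
    (h₂ μ w (hball w) (r / 2) hr2)
  have i₃ := hreg _ Q (A + 2 * B - α) _ 0 (by positivity) hEm'
    (h₃ μ 0 (hball 0) (r / 2) hr2)
  refine (lintegral_mono_ae ?_).trans ((lintegral_add_right _
    ((hmeas Q (A + 2 * B - α) 0).indicator hEm')).le.trans
    (add_le_add ((lintegral_add_right _
      ((hmeas (Q * r ^ (2 * B + A)) (-α) w).indicator (hEm w (r / 2)))).le.trans
      (add_le_add i₁ i₂)) i₃) |>.trans (le_of_eq ?_))
  · filter_upwards [Measure.ae_ne volume (0 : EuclideanSpace ℝ (Fin (m + 1))),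
      Measure.ae_ne volume w] with x hx0 hxw
    have ha : 0 < ‖x‖ := norm_pos_iff.2 hx0
    have hb : 0 < ‖x - w‖ := norm_pos_iff.2 (sub_ne_zero.2 hxw)
    have hab : r ≤ ‖x‖ + ‖x - w‖ := by
      have := norm_sub_le x (x - w)
      rwa [sub_sub_cancel] at this
    have hab' : ‖x‖ ≤ ‖x - w‖ + r := by
      have := norm_add_le (x - w) w
      rwa [sub_add_cancel] at this
    have key : ∀ (G k y : ℝ), 0 ≤ k → 0 ≤ y → G ≤ k * y →
        ENNReal.ofReal (G * |t - inner ℝ e x| ^ (-ε)) ≤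
          ENNReal.ofReal k * (H x * ENNReal.ofReal y) := by
      intro G k y hk hy hG
      rw [hH, ← ENNReal.ofReal_mul (by positivity), ← ENNReal.ofReal_mul hk]
      apply ENNReal.ofReal_le_ofReal
      calc G * |t - inner ℝ e x| ^ (-ε) ≤ k * y * |t - inner ℝ e x| ^ (-ε) := by gcongr
        _ = _ := by ring
    rcases rpow_mul_rpow_mul_rpow_le (A := A) hα hB hr ha hb hab hab' with
      ⟨h, hG⟩ | ⟨h, hG⟩ | ⟨h, hG⟩
    · have hx : x ∈ {x | 0 < dist x 0 ∧ dist x 0 ≤ r / 2} := by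
        simpa only [Set.mem_ofPred_eq, dist_zero_right] using ⟨ha, h⟩
      refine le_trans ?_ (le_add_right le_self_add)
      rw [Set.indicator_of_mem hx, dist_zero_right]
      exact key _ _ _ (by positivity) (by positivity) hG
    · have hx : x ∈ {x | 0 < dist x w ∧ dist x w ≤ r / 2} := by
        simpa only [Set.mem_ofPred_eq, dist_eq_norm] using ⟨hb, h⟩
      refine le_trans ?_ (le_add_right le_add_self)
      rw [Set.indicator_of_mem hx, dist_eq_norm]
      exact key _ _ _ (by positivity) (by positivity) hG
    · have hx : x ∈ {x | r / 2 ≤ dist x 0} := by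
        simpa only [Set.mem_ofPred_eq, dist_zero_right] using h
      refine le_trans ?_ le_add_self
      rw [Set.indicator_of_mem hx, dist_zero_right]
      exact key _ _ _ (by positivity) (by positivity) hG
  · rw [← ENNReal.ofReal_add (by positivity) (by positivity),
      ← ENNReal.ofReal_add (by positivity) (by positivity)]
    congr 1
    have e₁ : r ^ (A + 2 * B - α + d) = r ^ (2 * B - α) * r ^ (A + d) := by
      rw [← rpow_add hr]; congr 1; ring
    have e₂ : r ^ (A + 2 * B - α + d) = r ^ (2 * B + A) * r ^ (-α + d) := by
      rw [← rpow_add hr]; congr 1; ring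
    have hhalf : ∀ y : ℝ, (r / 2) ^ y = (1 / 2) ^ y * r ^ y := by
      intro y
      rw [← mul_rpow (by norm_num) hr.le]; congr 1; ring
    rw [hhalf, hhalf, hhalf]
    linear_combination (-(Q * C₁ * (1 / 2) ^ (A + d))) * e₁ -
      (Q * C₂ * (1 / 2) ^ (-α + d)) * e₂

lemma one_sub_rpow_eq {a b ε : ℝ} (hab : 1 + b ^ 2 - a ^ 2 ≠ 0) :
    4 * a ^ 2 * (1 + b ^ 2) / (1 + b ^ 2 + a ^ 2) ^ 2 < 1 ∧
    (1 - 4 * a ^ 2 * (1 + b ^ 2) / (1 + b ^ 2 + a ^ 2) ^ 2) ^ (-(ε / 2)) =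
      (1 + b ^ 2 + a ^ 2) ^ ε * |1 + b ^ 2 - a ^ 2| ^ (-ε) := by
  have hS : 0 < 1 + b ^ 2 + a ^ 2 := by positivity
  have h : 1 - 4 * a ^ 2 * (1 + b ^ 2) / (1 + b ^ 2 + a ^ 2) ^ 2 =
      (|1 + b ^ 2 - a ^ 2| / (1 + b ^ 2 + a ^ 2)) ^ 2 := by
    rw [div_pow, sq_abs]; field_simp; ring
  have hD : 0 < |1 + b ^ 2 - a ^ 2| := abs_pos.2 hab
  refine ⟨sub_pos.1 (h ▸ by positivity), ?_⟩
  rw [h, ← rpow_natCast, ← rpow_mul (by positivity), div_rpow hD.le hS.le]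
  rw [show ((2 : ℕ) : ℝ) * -(ε / 2) = -ε by push_cast; ring, rpow_neg hS.le, div_inv_eq_mul,
    mul_comm]

lemma one_add_norm_sub_sq_sub_eq {E : Type*} [NormedAddCommGroup E] [InnerProductSpace ℝ E]
    {w : E} (hw : w ≠ 0) (x : E) :
    1 + ‖x - w‖ ^ 2 - ‖x‖ ^ 2 =
      2 * ‖w‖ * ((1 + ‖w‖ ^ 2) / (2 * ‖w‖) - inner ℝ (‖w‖⁻¹ • w) x) := by
  have hr : ‖w‖ ≠ 0 := norm_ne_zero_iff.2 hw
  rw [norm_sub_sq_real, real_inner_smul_left, real_inner_comm]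
  field_simp
  ring

/-- Theorem 3 of the paper (delta-free form): the explicit evaluation `D(w)` of the
triple hyperbolic-surface convolution `Δₙ(w)` is uniformly bounded over `w ∈ ℝⁿ`. -/
theorem multilinear_embedding_stmt3 (n : ℕ) (hn : 2 ≤ n) (α₁ α₂ lam σ : ℝ)
    (hα₁0 : 0 < α₁) (hα₁n : α₁ < (n : ℝ)) (hα₂0 : 0 < α₂) (hα₂n : α₂ < (n : ℝ))
    (hlam : 0 < lam) (h1 : (n : ℝ) - 1 < α₁ + lam) (h2 : (n : ℝ) - 1 < α₂ + lam)
    (h3 : α₁ + α₂ < 2 * (n : ℝ) - 1)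
    (h4 : 2 * (n : ℝ) - 2 < α₁ + α₂ + lam) (h5 : α₁ + α₂ + lam < 3 * (n : ℝ) - 2)
    (hσ : σ = 2 + α₁ + α₂ + lam - 2 * (n : ℝ)) :
    ∃ C : ℝ, ∀ w : EuclideanSpace ℝ (Fin n),
      ‖w‖ ^ σ *
        ∫ x : EuclideanSpace ℝ (Fin n),
          ‖x‖ ^ (lam + α₂ - (n : ℝ)) * ‖x - w‖ ^ (-α₁) *
            (1 + ‖x - w‖ ^ 2 + ‖x‖ ^ 2) ^ ((n : ℝ) - 1 - lam - α₂) *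
            ∫ u in (0:ℝ)..1,
              u ^ ((lam + α₂ - (n : ℝ) + 1) / 2 - 1) * (1 - u) ^ (((n : ℝ) - 3) / 2) *
                (1 - (4 * ‖x‖ ^ 2 * (1 + ‖w - x‖ ^ 2) /
                  (1 + ‖w - x‖ ^ 2 + ‖x‖ ^ 2) ^ 2) * u) ^ (-(α₂ / 2))
        ≤ C := by
  obtain ⟨m, rfl⟩ : ∃ m, n = m + 1 := ⟨n - 1, by omega⟩
  have hm : (1 : ℝ) ≤ m := by exact_mod_cast (by omega : 1 ≤ m)
  push_cast at *
  obtain ⟨ε, hεl, hεu⟩ : ∃ ε, max 0 (α₂ - m) < ε ∧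
      ε < min (min (min α₂ 1) (m + 1 - α₁)) (min σ (lam + α₂ - m)) := by
    apply exists_between
    refine max_lt (lt_min (lt_min (lt_min ?_ ?_) ?_) (lt_min ?_ ?_))
      (lt_min (lt_min (lt_min ?_ ?_) ?_) (lt_min ?_ ?_)) <;> linarith
  simp only [max_lt_iff, lt_min_iff] at hεl hεu
  obtain ⟨hε0, hεα⟩ := hεl
  obtain ⟨⟨⟨hεα₂, hε1⟩, hεα₁⟩, hεσ, hεlam⟩ := hεu
  obtain ⟨K, hK, hJ⟩ := abs_integral_rpow_one_sub_mul_le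
    (p := (lam + α₂ - (m + 1) + 1) / 2 - 1) (k := ((m + 1 : ℝ) - 3) / 2) (α := α₂) (ε := ε)
    (by linarith) hε0.le hεα₂.le (by linarith)
  obtain ⟨C, hC, hint⟩ := lintegral_hyperplane_weight_le m (A := lam + α₂ - (m + 1)) (α := α₁)
    (B := (m + 1 : ℝ) - 1 - lam - α₂ + ε) (ε := ε) (d := m + 1 - ε) hε0 hε1 hα₁0.le (by linarith)
    rfl (by linarith) (by linarith) (by linarith)
  refine ⟨K * 2 ^ (-ε) * C, fun w => ?_⟩
  rcases eq_or_ne w 0 with rfl | hw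
  · rw [norm_zero, zero_rpow (by linarith), zero_mul]
    positivity
  have hr : 0 < ‖w‖ := norm_pos_iff.2 hw
  set e := ‖w‖⁻¹ • w with he_def
  have he : ‖e‖ = 1 := norm_smul_inv_norm hw
  have he0 : e ≠ 0 := norm_ne_zero_iff.1 (by rw [he]; norm_num)
  set t := (1 + ‖w‖ ^ 2) / (2 * ‖w‖) with ht
  have hI := hint e w he hw t
  suffices h : ∀ I : ℝ, ‖I‖ₑ ≤ ENNReal.ofReal (K * (2 * ‖w‖) ^ (-ε) *
      (C * ‖w‖ ^ (lam + α₂ - (m + 1) + 2 * ((m + 1 : ℝ) - 1 - lam - α₂ + ε) - α₁ +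
        (m + 1 - ε)))) → ‖w‖ ^ σ * I ≤ K * 2 ^ (-ε) * C by
    refine h _ ((enorm_integral_le_lintegral_enorm _).trans ?_)
    rw [ENNReal.ofReal_mul (by positivity)]
    refine le_trans ?_ (mul_le_mul_right hI _)
    rw [← lintegral_const_mul' _ _ ENNReal.ofReal_ne_top]
    refine lintegral_mono_ae ?_
    filter_upwards [ae_inner_ne he0 t] with x hx
    rw [← ENNReal.ofReal_mul (by positivity), Real.enorm_eq_ofReal_abs]
    apply ENNReal.ofReal_le_ofReal
    have hD := one_add_norm_sub_sq_sub_eq hw x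
    rw [← he_def, ← ht] at hD
    have hD0 : 1 + ‖x - w‖ ^ 2 - ‖x‖ ^ 2 ≠ 0 := by
      rw [hD]
      exact mul_ne_zero (by positivity) (sub_ne_zero.2 hx.symm)
    obtain ⟨hβ1, hβ⟩ := one_sub_rpow_eq (ε := ε) hD0
    rw [norm_sub_rev w x]
    have hS : 0 < 1 + ‖x - w‖ ^ 2 + ‖x‖ ^ 2 := by positivity
    have hJx := hJ _ (by positivity) hβ1
    rw [hβ, hD, abs_mul, abs_of_pos (by positivity : 0 < 2 * ‖w‖),
      mul_rpow (by positivity) (abs_nonneg _)] at hJx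
    rw [abs_mul, abs_of_nonneg (by positivity : 0 ≤ ‖x‖ ^ (lam + α₂ - ((m : ℝ) + 1)) *
      ‖x - w‖ ^ (-α₁) * (1 + ‖x - w‖ ^ 2 + ‖x‖ ^ 2) ^ ((m : ℝ) + 1 - 1 - lam - α₂))]
    refine (mul_le_mul_of_nonneg_left hJx (by positivity)).trans (le_of_eq ?_)
    rw [rpow_add hS]
    ring
  intro I hI
  rw [Real.enorm_eq_ofReal_abs, ENNReal.ofReal_le_ofReal_iff (by positivity)] at hI
  refine (mul_le_mul_of_nonneg_left ((le_abs_self I).trans hI) (by positivity)).trans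
    (le_of_eq ?_)
  rw [mul_rpow (by norm_num) hr.le]
  have hexp : ‖w‖ ^ σ * (‖w‖ ^ (-ε) * ‖w‖ ^ (lam + α₂ - (m + 1) +
      2 * ((m + 1 : ℝ) - 1 - lam - α₂ + ε) - α₁ + (m + 1 - ε))) = 1 := by
    rw [← rpow_add hr, ← rpow_add hr]
    convert rpow_zero ‖w‖ using 2
    rw [hσ]; ring
  linear_combination (K * 2 ^ (-ε) * C) * hexp
end

section
/- Let n ≥ 2 be an integer and α₁, α₂, λ, γ real numbers with 0 < α₁ < n, n-1 ≤ α₂ < n, λ > 0, α₁ + λ > n-1, α₁ + α₂ + λ > 2n-2, α₁ + α₂ < 2n-1, and max{1-α₂, α₂-(n-1)} < 2γ < min{n-α₁, α₁+α₂+λ-2(n-1), 1}; set σ = 2 + α₁ + α₂ + λ - 2n. Then sup_{w ∈ ℝⁿ} |w|^σ ∫_{ℝⁿ} |x-w|^{-α₁} (1 + |x-w|² + |x|²)^{-(λ+α₂-n)/2 + 2γ - 1} · |1 + |x-w|² − |x|²|^{-2γ} dx < ∞. -/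
open MeasureTheory Real

/-- A power singularity at the origin with polynomial decay is integrable on the line. -/
lemma integrable_abs_rpow_mul_one_add_sq_rpow {c d : ℝ} (hc : c < 1) (_hd : 0 ≤ d)
    (hcd : 1 < c + 2 * d) :
    Integrable fun t : ℝ => |t| ^ (-c) * (1 + t ^ 2) ^ (-d) := by
  have hmeas : Measurable fun t : ℝ => |t| ^ (-c) * (1 + t ^ 2) ^ (-d) := by fun_prop
  have hnear : IntegrableOn (fun t : ℝ => |t| ^ (-c) * (1 + t ^ 2) ^ (-d)) (Set.Ioc 0 1) := by
    have hpow : IntegrableOn (fun t : ℝ => t ^ (-c)) (Set.Ioc 0 1) := by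
      rw [← intervalIntegrable_iff_integrableOn_Ioc_of_le zero_le_one]
      exact intervalIntegral.intervalIntegrable_rpow' (by linarith)
    refine hpow.mono' hmeas.aestronglyMeasurable ?_
    filter_upwards [ae_restrict_mem measurableSet_Ioc] with t ht
    rw [Real.norm_of_nonneg (by positivity), abs_of_pos ht.1]
    exact mul_le_of_le_one_right (rpow_nonneg ht.1.le _)
      (rpow_le_one_of_one_le_of_nonpos (by nlinarith [sq_nonneg t]) (by linarith))
  have hfar : IntegrableOn (fun t : ℝ => |t| ^ (-c) * (1 + t ^ 2) ^ (-d)) (Set.Ioi 1) := by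
    refine (integrableOn_Ioi_rpow_of_lt (a := -c - 2 * d) (by linarith) one_pos).mono'
      hmeas.aestronglyMeasurable ?_
    filter_upwards [ae_restrict_mem measurableSet_Ioi] with t ht
    have ht0 : 0 < t := one_pos.trans ht
    rw [Real.norm_of_nonneg (by positivity), abs_of_pos ht0, sub_eq_add_neg, rpow_add ht0,
      show -(2 * d) = 2 * (-d) by ring, rpow_mul ht0.le, rpow_two]
    gcongr ?_ * ?_
    exact rpow_le_rpow_of_nonpos (by positivity) (by linarith) (by linarith)
  have hpos : IntegrableOn (fun t : ℝ => |t| ^ (-c) * (1 + t ^ 2) ^ (-d)) (Set.Ioi 0) := by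
    rw [← Set.Ioc_union_Ioi_eq_Ioi (zero_le_one' ℝ)]
    exact hnear.union hfar
  have hneg : IntegrableOn (fun t : ℝ => |t| ^ (-c) * (1 + t ^ 2) ^ (-d)) (Set.Iic 0) := by
    have := ((Measure.measurePreserving_neg (volume : Measure ℝ)).integrableOn_comp_preimage
      (Homeomorph.neg ℝ).measurableEmbedding).2
      ((integrableOn_Ici_iff_integrableOn_Ioi (μ := volume)).2 hpos)
    simpa [Function.comp_def] using this
  rw [← integrableOn_univ, ← Set.Iic_union_Ioi (a := (0 : ℝ))]
  exact hneg.union hpos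

section AxialKernel

variable {ι : Type*} [Fintype ι]

/-- The radially decreasing weight `‖u‖ ^ (-α) (R² + ‖u‖²) ^ (-β)`, made singular on the
hyperplane `u i = 0`. -/
noncomputable def axialKernel (α β a R : ℝ) (i : ι) (u : EuclideanSpace ℝ ι) : ℝ :=
  ‖u‖ ^ (-α) * (R ^ 2 + ‖u‖ ^ 2) ^ (-β) * |u i| ^ (-a)

lemma axialKernel_nonneg (α β a R : ℝ) (i : ι) (u : EuclideanSpace ℝ ι) :
    0 ≤ axialKernel α β a R i u := by
  unfold axialKernel; positivity

lemma ae_apply_ne_zero (i : ι) : ∀ᵐ u : EuclideanSpace ℝ ι, u i ≠ 0 := by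
  have hmp := EuclideanSpace.volume_preserving_symm_measurableEquiv_toLp ι
  simpa using hmp.quasiMeasurePreserving.ae
    (Measure.ae_eval_ne (fun _ => volume) i (0 : ℝ))

/-- A weight that splits into powers is dominated by a product of one-variable weights. -/
lemma rpow_neg_norm_mul_le_prod {α β : ℝ} (hα : 0 ≤ α) (hβ : 0 ≤ β) {ω : ι → ℝ}
    (hω : ∀ j, 0 ≤ ω j) (hω1 : ∑ j, ω j = 1) {u : EuclideanSpace ℝ ι} (hu : ∀ j, u j ≠ 0) :
    ‖u‖ ^ (-α) * (1 + ‖u‖ ^ 2) ^ (-β) ≤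
      ∏ j, (|u j| ^ (-(α * ω j)) * (1 + u j ^ 2) ^ (-(β * ω j))) := by
  have hle (j : ι) : |u j| ≤ ‖u‖ := PiLp.norm_apply_le u j
  have hne : Nonempty ι := by
    by_contra h
    rw [not_nonempty_iff] at h
    simp at hω1
  have hu0 : 0 < ‖u‖ := (abs_pos.2 (hu hne.some)).trans_le (hle _)
  have hsplit (r s : ℝ) (hr : 0 < r) : r ^ (-s) = ∏ j, r ^ (-(s * ω j)) := by
    rw [← rpow_sum_of_pos hr, Finset.sum_neg_distrib, ← Finset.mul_sum, hω1, mul_one]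
  rw [hsplit _ α hu0, hsplit _ β (by positivity), ← Finset.prod_mul_distrib]
  refine Finset.prod_le_prod (fun j _ => by positivity) fun j _ => ?_
  have hj := hω j
  have hlej := hle j
  have huj := abs_pos.2 (hu j)
  refine mul_le_mul (rpow_le_rpow_of_nonpos huj hlej (by nlinarith)) ?_ (by positivity)
    (by positivity)
  refine rpow_le_rpow_of_nonpos (by positivity) ?_ (by nlinarith)
  rw [← sq_abs (u j)]
  gcongr

lemma integrable_axialKernel_one {α β a : ℝ} (hα : 0 ≤ α) (hβ : 0 ≤ β) (ha1 : a < 1)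
    (hαa : α + a < Fintype.card ι) (hαβa : Fintype.card ι < α + 2 * β + a) (i : ι) :
    Integrable (axialKernel α β a 1 i) := by
  classical
  set N : ℝ := (Fintype.card ι : ℝ) with hN
  have hNa : 0 < N - a := by linarith
  set δ : ι → ℝ := fun j => if j = i then a else 0 with hδ
  have hδ1 (j : ι) : δ j < 1 := by simp only [hδ]; split_ifs <;> linarith
  set ω : ι → ℝ := fun j => (1 - δ j) / (N - a) with hωdef
  have hω (j : ι) : 0 < ω j := div_pos (by linarith [hδ1 j]) hNa
  have hωmul (j : ι) : ω j * (N - a) = 1 - δ j := div_mul_cancel₀ _ hNa.ne'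
  have hω1 : ∑ j, ω j = 1 := by
    rw [← Finset.sum_div, Finset.sum_sub_distrib]
    simp [hδ, ← hN, hNa.ne']
  have hfac (j : ι) : Integrable fun t : ℝ =>
      |t| ^ (-(α * ω j + δ j)) * (1 + t ^ 2) ^ (-(β * ω j)) := by
    have := hω j
    have := hωmul j
    refine integrable_abs_rpow_mul_one_add_sq_rpow ?_ (by positivity) ?_ <;> nlinarith
  have hprod : Integrable fun u : EuclideanSpace ℝ ι =>
      ∏ j, (|u j| ^ (-(α * ω j + δ j)) * (1 + u j ^ 2) ^ (-(β * ω j))) :=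
    ((EuclideanSpace.volume_preserving_symm_measurableEquiv_toLp ι).integrable_comp_emb
      (MeasurableEquiv.measurableEmbedding _)).2 (Integrable.fintype_prod hfac)
  refine hprod.mono' (by unfold axialKernel; fun_prop) ?_
  filter_upwards [ae_all_iff.2 ae_apply_ne_zero] with u hu
  rw [Real.norm_of_nonneg (axialKernel_nonneg _ _ _ _ _ _), axialKernel, one_pow]
  have hi : |u i| ^ (-a) = ∏ j, |u j| ^ (-(δ j)) := by
    rw [Finset.prod_eq_single i] <;> simp +contextual [hδ]
  rw [hi]
  calc _ ≤ (∏ j, (|u j| ^ (-(α * ω j)) * (1 + u j ^ 2) ^ (-(β * ω j)))) *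
          ∏ j, |u j| ^ (-(δ j)) := by
        gcongr
        exact rpow_neg_norm_mul_le_prod hα hβ (fun j => (hω j).le) hω1 hu
    _ = _ := by
        rw [← Finset.prod_mul_distrib]
        refine Finset.prod_congr rfl fun j _ => ?_
        rw [neg_add, rpow_add (abs_pos.2 (hu j))]
        ring

lemma axialKernel_eq_smul {α β a R : ℝ} (hR : 0 < R) (i : ι) (u : EuclideanSpace ℝ ι) :
    axialKernel α β a R i u = R ^ (-(α + 2 * β + a)) * axialKernel α β a 1 i (R⁻¹ • u) := by
  have hsum : R ^ 2 + ‖u‖ ^ 2 = R ^ 2 * (1 + ‖R⁻¹ • u‖ ^ 2) := by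
    rw [norm_smul, Real.norm_of_nonneg (by positivity)]
    field_simp
  have hnorm : ‖u‖ = R * ‖R⁻¹ • u‖ := by
    rw [norm_smul, Real.norm_of_nonneg (by positivity)]
    field_simp
  have hcoord : |u i| = R * |(R⁻¹ • u) i| := by
    rw [PiLp.smul_apply, smul_eq_mul, abs_mul, abs_of_pos (inv_pos.2 hR)]
    field_simp
  have hR2 : (R ^ 2) ^ (-β) = R ^ (-(2 * β)) := by
    rw [← rpow_two, ← rpow_mul hR.le]; ring_nf
  rw [axialKernel, axialKernel, hsum, hcoord, one_pow]
  nth_rewrite 1 [hnorm]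
  rw [mul_rpow hR.le (norm_nonneg _), mul_rpow (by positivity) (by positivity),
    mul_rpow hR.le (abs_nonneg _), hR2, neg_add, neg_add, rpow_add hR, rpow_add hR]
  ring

lemma integrable_axialKernel {α β a R : ℝ} (hα : 0 ≤ α) (hβ : 0 ≤ β) (ha1 : a < 1)
    (hαa : α + a < Fintype.card ι) (hαβa : Fintype.card ι < α + 2 * β + a) (hR : 0 < R) (i : ι) :
    Integrable (axialKernel α β a R i) := by
  simp_rw [funext (axialKernel_eq_smul hR i)]
  exact ((integrable_axialKernel_one hα hβ ha1 hαa hαβa i).comp_smul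
    (inv_ne_zero hR.ne')).const_mul _

lemma integral_axialKernel {α β a R : ℝ} (hR : 0 < R) (i : ι) :
    ∫ u, axialKernel α β a R i u =
      R ^ (Fintype.card ι - (α + 2 * β + a)) * ∫ u, axialKernel α β a 1 i u := by
  simp_rw [axialKernel_eq_smul hR i]
  rw [integral_const_mul, Measure.integral_comp_inv_smul_of_nonneg _ _ hR.le,
    finrank_euclideanSpace, smul_eq_mul, sub_eq_add_neg, rpow_add hR, rpow_natCast]
  ring

/-- Translating the singular hyperplane off the centre of a radially decreasing weight is controlled
by the centred kernel and its translate. -/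
lemma mul_abs_sub_rpow_le_axialKernel_add [DecidableEq ι] {α β a R : ℝ} (hα : 0 < α)
    (hβ : 0 ≤ β) (ha : 0 < a) (hR : 0 < R) (s : ℝ) {i : ι} {u : EuclideanSpace ℝ ι} (hu : u i ≠ 0) :
    ‖u‖ ^ (-α) * (R ^ 2 + ‖u‖ ^ 2) ^ (-β) * |u i - s| ^ (-a) ≤
      axialKernel α β a R i u + axialKernel α β a R i (u - EuclideanSpace.single i s) := by
  rcases le_total |u i| |u i - s| with h | h
  · refine le_add_of_le_of_nonneg ?_ (axialKernel_nonneg _ _ _ _ _ _)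
    unfold axialKernel
    gcongr ?_ * ?_
    exact rpow_le_rpow_of_nonpos (abs_pos.2 hu) h (by linarith)
  · refine le_add_of_nonneg_of_le (axialKernel_nonneg _ _ _ _ _ _) ?_
    set v := u - EuclideanSpace.single i s with hv
    have hvi : v i = u i - s := by simp [hv]
    rcases eq_or_ne (u i - s) 0 with h0 | h0
    · rw [h0, abs_zero, zero_rpow (by linarith), mul_zero]
      exact axialKernel_nonneg _ _ _ _ _ _
    have hvu : ‖v‖ ≤ ‖u‖ := by
      rw [EuclideanSpace.norm_eq, EuclideanSpace.norm_eq]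
      gcongr with j
      rcases eq_or_ne j i with rfl | hj
      · rwa [hvi]
      · simp [hv, hj]
    have hv0 : 0 < ‖v‖ := (abs_pos.2 h0).trans_le (hvi ▸ PiLp.norm_apply_le v i)
    rw [axialKernel, hvi]
    gcongr ?_ * ?_ * _
    · exact rpow_le_rpow_of_nonpos hv0 hvu (by linarith)
    · exact rpow_le_rpow_of_nonpos (by positivity) (by gcongr) (by linarith)

/-- The uniform estimate for a fixed nonzero translation vector, up to the constant
`∫ axialKernel α β a 1 i`. -/
lemma integral_translate_le [DecidableEq ι] {α β a : ℝ} (hα : 0 < α) (hβ : 0 ≤ β) (ha : 0 < a)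
    (ha1 : a < 1) (hαa : α + a < Fintype.card ι) (hαβa : Fintype.card ι < α + 2 * β + a) (i : ι)
    {w : EuclideanSpace ℝ ι} (hw : w ≠ 0) :
    ∫ x : EuclideanSpace ℝ ι, ‖x - w‖ ^ (-α) * (1 + ‖x - w‖ ^ 2 + ‖x‖ ^ 2) ^ (-β) *
        |1 + ‖x - w‖ ^ 2 - ‖x‖ ^ 2| ^ (-a) ≤
      4 ^ β * (2 * ‖w‖) ^ (-a) * (2 * (√(1 + ‖w‖ ^ 2) ^ (Fintype.card ι - (α + 2 * β + a)) *
        ∫ u, axialKernel α β a 1 i u)) := by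
  set r := ‖w‖ with hr
  have hr0 : 0 < r := norm_pos_iff.2 hw
  set R := √(1 + r ^ 2) with hRdef
  have hR : 0 < R := by positivity
  have hR2 : R ^ 2 = 1 + r ^ 2 := sq_sqrt (by positivity)
  set s := (1 - r ^ 2) / (2 * r) with hs
  obtain ⟨b, hb⟩ : ∃ b : OrthonormalBasis ι ℝ (EuclideanSpace ℝ ι), b i = r⁻¹ • w := by
    have hv : Orthonormal ℝ (({i} : Set ι).domRestrict fun _ => r⁻¹ • w) := by
      refine ⟨fun _ => ?_, fun j k hjk => (hjk (Subsingleton.elim _ _)).elim⟩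
      simp [norm_smul, ← hr, abs_of_pos hr0, hr0.ne']
    obtain ⟨b, hb⟩ := hv.exists_orthonormalBasis_extension_of_card_eq finrank_euclideanSpace
    exact ⟨b, hb i rfl⟩
  have hmp := b.measurePreserving_repr
  have hemb : MeasurableEmbedding b.repr := b.repr.toHomeomorph.measurableEmbedding
  have hK := integrable_axialKernel hα.le hβ ha1 hαa hαβa hR i
  have hKs := hK.comp_sub_right (EuclideanSpace.single i s)
  rw [← integral_add_right_eq_self _ w]
  calc _ ≤ ∫ y, 4 ^ β * (2 * r) ^ (-a) * (axialKernel α β a R i (b.repr y) +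
          axialKernel α β a R i (b.repr y - EuclideanSpace.single i s)) := by
        refine integral_mono_of_nonneg (.of_forall fun y => by positivity)
          ((((hmp.integrable_comp_emb hemb).2 (hK.add hKs))).const_mul _) ?_
        filter_upwards [hmp.quasiMeasurePreserving.ae (ae_apply_ne_zero i)] with y hy
        have hmain := mul_abs_sub_rpow_le_axialKernel_add hα hβ ha hR s hy
        have hinner : inner ℝ y w = r * b.repr y i := by
          rw [b.repr_apply_apply, hb, inner_smul_left, real_inner_comm]
          simp [hr0.ne']
        rw [b.repr.norm_map] at hmain
        have hsq : ‖y + w‖ ^ 2 = ‖y‖ ^ 2 + 2 * (r * b.repr y i) + r ^ 2 := by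
          rw [norm_add_sq_real, hinner]
        have hlin : |1 + ‖y‖ ^ 2 - ‖y + w‖ ^ 2| = 2 * r * |b.repr y i - s| := by
          rw [← abs_of_pos (show 0 < 2 * r by positivity), ← abs_mul, ← abs_neg, hsq, hs]
          congr 1
          field_simp
          ring
        have hcmp : 4⁻¹ * (R ^ 2 + ‖y‖ ^ 2) ≤ 1 + ‖y‖ ^ 2 + ‖y + w‖ ^ 2 := by
          have h1 : r ≤ ‖y + w‖ + ‖y‖ := by simpa using norm_sub_le (y + w) y
          rw [hR2]
          have h2 := pow_le_pow_left₀ hr0.le h1 2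
          linarith [add_sq_le (a := ‖y + w‖) (b := ‖y‖), sq_nonneg ‖y + w‖, sq_nonneg ‖y‖]
        have hrad : (1 + ‖y‖ ^ 2 + ‖y + w‖ ^ 2) ^ (-β) ≤ 4 ^ β * (R ^ 2 + ‖y‖ ^ 2) ^ (-β) := by
          refine (rpow_le_rpow_of_nonpos (by positivity) hcmp (by linarith)).trans_eq ?_
          rw [mul_rpow (by norm_num) (by positivity), inv_rpow (by norm_num),
            rpow_neg (by norm_num), inv_inv]
        rw [add_sub_cancel_right, hlin, mul_rpow (by positivity) (abs_nonneg _)]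
        calc _ ≤ ‖y‖ ^ (-α) * (4 ^ β * (R ^ 2 + ‖y‖ ^ 2) ^ (-β)) *
              ((2 * r) ^ (-a) * |b.repr y i - s| ^ (-a)) := by gcongr
          _ = 4 ^ β * (2 * r) ^ (-a) *
              (‖y‖ ^ (-α) * (R ^ 2 + ‖y‖ ^ 2) ^ (-β) * |b.repr y i - s| ^ (-a)) := by ring
          _ ≤ _ := by gcongr
    _ = _ := by
        rw [integral_const_mul, hmp.integral_comp hemb (fun u => axialKernel α β a R i u +
          axialKernel α β a R i (u - EuclideanSpace.single i s)), integral_add hK hKs,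
          integral_sub_right_eq_self, integral_axialKernel hR]
        ring

end AxialKernel

/-- Step 2 of the proof of Theorem 3 of the paper: the uniform bound
`sup_w |w|^σ ∫ |x-w|^{-α₁} (1+|x-w|²+|x|²)^{-(λ+α₂-n)/2+2γ-1} |1+|x-w|²-|x|²|^{-2γ} dx < ∞`. -/
theorem multilinear_embedding_stmt8 (n : ℕ) (hn : 2 ≤ n) (α₁ α₂ lam γ σ : ℝ)
    (hα₁0 : 0 < α₁) (hα₁n : α₁ < (n : ℝ))
    (hα₂1 : (n : ℝ) - 1 ≤ α₂) (hα₂n : α₂ < (n : ℝ)) (hlam : 0 < lam)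
    (h1 : (n : ℝ) - 1 < α₁ + lam) (h2 : 2 * (n : ℝ) - 2 < α₁ + α₂ + lam)
    (h3 : α₁ + α₂ < 2 * (n : ℝ) - 1)
    (hγlow : max (1 - α₂) (α₂ - ((n : ℝ) - 1)) < 2 * γ)
    (hγhigh : 2 * γ < min ((n : ℝ) - α₁) (min (α₁ + α₂ + lam - 2 * ((n : ℝ) - 1)) 1))
    (hσ : σ = 2 + α₁ + α₂ + lam - 2 * (n : ℝ)) :
    ∃ C : ℝ, ∀ w : EuclideanSpace ℝ (Fin n),
      ‖w‖ ^ σ *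
        ∫ x : EuclideanSpace ℝ (Fin n),
          ‖x - w‖ ^ (-α₁) *
            (1 + ‖x - w‖ ^ 2 + ‖x‖ ^ 2) ^ (-(lam + α₂ - (n : ℝ)) / 2 + 2 * γ - 1) *
            |1 + ‖x - w‖ ^ 2 - ‖x‖ ^ 2| ^ (-(2 * γ))
        ≤ C := by
  obtain ⟨-, hγlow⟩ := max_lt_iff.1 hγlow
  obtain ⟨hγα, hγhigh⟩ := lt_min_iff.1 hγhigh
  obtain ⟨hγσ, hγ1⟩ := lt_min_iff.1 hγhigh
  set a := 2 * γ with ha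
  set β := (lam + α₂ - (n : ℝ)) / 2 - a + 1 with hβ
  have hexp : -(lam + α₂ - (n : ℝ)) / 2 + a - 1 = -β := by rw [hβ]; ring
  let i : Fin n := ⟨0, by omega⟩
  have hσa : n - (α₁ + 2 * β + a) = -(σ - a) := by rw [hβ, hσ]; ring
  set I := ∫ u, axialKernel α₁ β a 1 i u
  have hI : 0 ≤ I := integral_nonneg fun u => axialKernel_nonneg _ _ _ _ _ _
  refine ⟨4 ^ β * 2 ^ (-a) * 2 * I, fun w => ?_⟩
  rcases eq_or_ne w 0 with rfl | hw
  · rw [norm_zero, zero_rpow (by linarith), zero_mul]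
    positivity
  have hbound := integral_translate_le hα₁0 (β := β) (by linarith) (a := a) (by linarith) hγ1
    (by rw [Fintype.card_fin]; linarith) (by rw [Fintype.card_fin]; linarith) i hw
  rw [Fintype.card_fin, hσa] at hbound
  simp only [hexp]
  have hr : 0 < ‖w‖ := norm_pos_iff.2 hw
  have hle : ‖w‖ ^ (σ - a) * √(1 + ‖w‖ ^ 2) ^ (-(σ - a)) ≤ 1 := by
    rw [rpow_neg (sqrt_nonneg _), ← div_eq_mul_inv]
    refine div_le_one_of_le₀ ?_ (by positivity)
    exact rpow_le_rpow hr.le (le_sqrt_of_sq_le (by linarith)) (by linarith)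
  calc _ ≤ ‖w‖ ^ σ * (4 ^ β * (2 * ‖w‖) ^ (-a) * (2 * (√(1 + ‖w‖ ^ 2) ^ (-(σ - a)) * I))) :=
        mul_le_mul_of_nonneg_left hbound (by positivity)
    _ = 4 ^ β * 2 ^ (-a) * 2 * I * (‖w‖ ^ (σ - a) * √(1 + ‖w‖ ^ 2) ^ (-(σ - a))) := by
        rw [mul_rpow two_pos.le hr.le, sub_eq_add_neg σ a, rpow_add hr]
        ring
    _ ≤ _ := mul_le_of_le_one_right (by positivity) hle
end

section
/- Let n ≥ 1 and m ≥ 1 be integers, let α₀ be a real number with 0 < α₀ < n, and set p = 2n/(n-α₀). Then there is a constant c > 0 such that for every Schwartz function f on (ℝⁿ)^m, ( ∫_{(ℝⁿ)^m} |f(x)|^p dx )^{2/p} ≤ c ∫_{(ℝⁿ)^m} ( ∏_{k=1}^m |ξ_k|^{α₀} ) |f̂(ξ₁, …, ξ_m)|² dξ₁ ⋯ dξ_m, where f̂ denotes the Fourier transform of f. -/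
open MeasureTheory Real RealInnerProductSpace
open scoped ENNReal FourierTransform SchwartzMap

section Cutoff

variable {V : Type*} [NormedAddCommGroup V] [InnerProductSpace ℝ V] [FiniteDimensional ℝ V]

/-- Splitting of the frequency variable at scale `R`, with a smooth cutoff. -/
theorem exists_frequency_cutoff (R : ℝ) (hR : 0 < R) :
    ∃ χ : V → ℂ, Function.HasTemperateGrowth χ ∧
      (∀ ξ, ‖χ ξ‖ₑ ≤ (Metric.ball (0 : V) (2 * R)).indicator 1 ξ) ∧
      (∀ ξ, ‖1 - χ ξ‖ₑ ≤ (Metric.ball (0 : V) R)ᶜ.indicator 1 ξ) := by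
  let b : ContDiffBump (0 : V) := ⟨R, 2 * R, hR, by linarith⟩
  have hsm : ContDiff ℝ ((⊤ : ℕ∞) : WithTop ℕ∞) (fun ξ ↦ ((b ξ : ℝ) : ℂ)) :=
    Complex.ofRealCLM.contDiff.comp b.contDiff
  have hsupp : HasCompactSupport (fun ξ ↦ ((b ξ : ℝ) : ℂ)) :=
    b.hasCompactSupport.comp_left (g := Complex.ofReal) Complex.ofReal_zero
  refine ⟨fun ξ ↦ (b ξ : ℂ), ?_, fun ξ ↦ ?_, fun ξ ↦ ?_⟩
  · exact hsupp.hasTemperateGrowth hsm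
  · by_cases h : ξ ∈ Metric.ball (0 : V) (2 * R)
    · rw [Set.indicator_of_mem h, Pi.one_apply, ← ofReal_norm, Complex.norm_real,
        Real.norm_of_nonneg b.nonneg, ENNReal.ofReal_le_one]
      exact b.le_one
    · dsimp only
      rw [Set.indicator_of_notMem h, b.zero_of_le_dist (by simpa [b] using h)]
      simp
  · by_cases h : ξ ∈ Metric.ball (0 : V) R
    · dsimp only
      rw [Set.indicator_of_notMem (by simpa using h),
        b.one_of_mem_closedBall (Metric.ball_subset_closedBall h)]
      simp
    · rw [Set.indicator_of_mem (by simpa using h), Pi.one_apply, ← Complex.ofReal_one,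
        ← Complex.ofReal_sub, ← ofReal_norm, Complex.norm_real,
        Real.norm_of_nonneg (by linarith [b.le_one (x := ξ)]), ENNReal.ofReal_le_one]
      linarith [b.nonneg (x := ξ)]

end Cutoff

section Sobolev

variable {V : Type*} [NormedAddCommGroup V] [InnerProductSpace ℝ V] [FiniteDimensional ℝ V]
  [MeasurableSpace V] [BorelSpace V]

/-- The integral of `‖ξ‖ ^ (-a)` over a ball is finite and scales like `R ^ (dim V - a)`. -/
theorem exists_lintegral_ball_norm_rpow_neg_eq {a : ℝ} (ha0 : 0 < a)
    (had : a < Module.finrank ℝ V) :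
    ∃ K : ℝ, 0 < K ∧ ∀ R : ℝ, 0 < R →
      ∫⁻ ξ in Metric.ball (0 : V) R, ENNReal.ofReal (‖ξ‖ ^ (-a))
        ≤ ENNReal.ofReal (K * R ^ (Module.finrank ℝ V - a)) := by
  have hd : 1 ≤ Module.finrank ℝ V := by
    have : (0 : ℝ) < Module.finrank ℝ V := ha0.trans had
    exact_mod_cast this
  have hint (R : ℝ) : IntegrableOn (fun ξ : V ↦ ‖ξ‖ ^ (-a)) (Metric.ball 0 R) := by
    refine integrableOn_ball_of_norm_le_rpow (C := 1) hd had ?_ ?_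
    · exact .of_forall fun x ↦ by
        rw [one_mul, Real.norm_of_nonneg (by positivity)]
    · exact (by fun_prop : Measurable fun ξ : V ↦ ‖ξ‖ ^ (-a)).aestronglyMeasurable
  refine ⟨1 + ∫ ξ in Metric.ball (0 : V) 1, ‖ξ‖ ^ (-a), ?_, fun R hR ↦ ?_⟩
  · have : 0 ≤ ∫ ξ in Metric.ball (0 : V) 1, ‖ξ‖ ^ (-a) :=
      integral_nonneg fun _ ↦ by positivity
    linarith
  rw [← ofReal_integral_eq_lintegral_ofReal (hint R) (.of_forall fun _ ↦ by positivity)]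
  apply ENNReal.ofReal_le_ofReal
  have h := Measure.setIntegral_comp_smul_of_pos (volume : Measure V)
    (fun ξ : V ↦ ‖ξ‖ ^ (-a)) (Metric.ball 0 1) hR
  rw [smul_unitBall_of_pos hR] at h
  have h' : ∫ ξ in Metric.ball (0 : V) 1, ‖R • ξ‖ ^ (-a)
      = R ^ (-a) * ∫ ξ in Metric.ball (0 : V) 1, ‖ξ‖ ^ (-a) := by
    rw [← integral_const_mul]
    congr 1 with ξ
    rw [norm_smul, Real.norm_of_nonneg hR.le, mul_rpow hR.le (norm_nonneg _)]
  rw [h', smul_eq_mul, eq_comm, inv_mul_eq_iff_eq_mul₀ (by positivity)] at h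
  rw [h, ← mul_assoc, ← rpow_natCast, ← rpow_add hR, ← sub_eq_add_neg, mul_comm]
  gcongr
  linarith

/-- Low frequency estimate, by Cauchy–Schwarz against the weight `‖ξ‖ ^ a`. -/
theorem exists_sq_lintegral_ball_enorm_le {a : ℝ} (ha0 : 0 < a) (had : a < Module.finrank ℝ V) :
    ∃ K : ℝ, 0 < K ∧ ∀ R : ℝ, 0 < R → ∀ G : V → ℂ, Measurable G →
      (∫⁻ ξ in Metric.ball (0 : V) R, ‖G ξ‖ₑ) ^ 2
        ≤ ENNReal.ofReal (K * R ^ (Module.finrank ℝ V - a)) *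
          ∫⁻ ξ, ENNReal.ofReal (‖ξ‖ ^ a) * ‖G ξ‖ₑ ^ 2 := by
  obtain ⟨K, hK, hKR⟩ := exists_lintegral_ball_norm_rpow_neg_eq (V := V) ha0 had
  have hnt : Nontrivial V := by
    rw [← Module.finrank_pos_iff (R := ℝ)]
    exact_mod_cast ha0.trans had
  refine ⟨K, hK, fun R hR G hG ↦ ?_⟩
  have key := ENNReal.lintegral_mul_le_Lp_mul_Lq (volume.restrict (Metric.ball (0 : V) R))
    Real.HolderConjugate.two_two
    (f := fun ξ ↦ ENNReal.ofReal (‖ξ‖ ^ (-a / 2)))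
    (g := fun ξ ↦ ENNReal.ofReal (‖ξ‖ ^ (a / 2)) * ‖G ξ‖ₑ)
    (by fun_prop) (by fun_prop)
  have h1 : ∫⁻ ξ in Metric.ball (0 : V) R, ‖G ξ‖ₑ = ∫⁻ ξ in Metric.ball (0 : V) R,
      ((fun ξ : V ↦ ENNReal.ofReal (‖ξ‖ ^ (-a / 2))) *
        fun ξ : V ↦ ENNReal.ofReal (‖ξ‖ ^ (a / 2)) * ‖G ξ‖ₑ : V → ℝ≥0∞) ξ := by
    refine lintegral_congr_ae (ae_restrict_of_ae ?_)
    filter_upwards [compl_mem_ae_iff.2 (measure_singleton (0 : V))] with ξ hξ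
    have hξ' : 0 < ‖ξ‖ := norm_pos_iff.2 hξ
    rw [Pi.mul_apply, ← mul_assoc, ← ENNReal.ofReal_mul (by positivity), ← rpow_add hξ']
    simp [neg_div]
  have sq_rpow (x : ℝ≥0∞) : (x ^ (1 / 2 : ℝ)) ^ 2 = x := by
    rw [← ENNReal.rpow_natCast, ← ENNReal.rpow_mul]
    norm_num
  have ofReal_sq (b : ℝ) (ξ : V) :
      ENNReal.ofReal (‖ξ‖ ^ (b / 2)) ^ 2 = ENNReal.ofReal (‖ξ‖ ^ b) := by
    rw [← ENNReal.ofReal_pow (by positivity), ← rpow_natCast, ← rpow_mul (norm_nonneg _)]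
    norm_num
  rw [← h1] at key
  calc (∫⁻ ξ in Metric.ball (0 : V) R, ‖G ξ‖ₑ) ^ 2
      ≤ _ := pow_le_pow_left' key 2
    _ = (∫⁻ ξ in Metric.ball (0 : V) R, ENNReal.ofReal (‖ξ‖ ^ (-a))) *
        ∫⁻ ξ in Metric.ball (0 : V) R, ENNReal.ofReal (‖ξ‖ ^ a) * ‖G ξ‖ₑ ^ 2 := by
      rw [mul_pow, sq_rpow, sq_rpow]
      simp only [ENNReal.rpow_two, mul_pow, ofReal_sq]
    _ ≤ _ := by
      gcongr
      · exact hKR R hR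
      · exact Measure.restrict_le_self

theorem lintegral_enorm_sq_fourier (f : 𝓢(V, ℂ)) :
    ∫⁻ x, ‖𝓕 (f : V → ℂ) x‖ₑ ^ 2 = ∫⁻ ξ, ‖f ξ‖ₑ ^ 2 := by
  have key (g : 𝓢(V, ℂ)) : ∫⁻ x, ‖g x‖ₑ ^ 2 = ENNReal.ofReal (∫ x, ‖g x‖ ^ 2) := by
    have h : Integrable (fun x ↦ ‖g x‖ ^ 2) := (g.memLp 2).integrable_norm_pow (by simp)
    rw [ofReal_integral_eq_lintegral_ofReal h (.of_forall fun _ ↦ by positivity)]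
    simp [ENNReal.ofReal_pow]
  rw [← SchwartzMap.fourier_coe, key, key, SchwartzMap.integral_norm_sq_fourier]

theorem measurable_uncurry_fourier {Y : Type*} [MeasurableSpace Y] {G : Y → V → ℂ}
    (hG : Measurable (Function.uncurry G)) :
    Measurable (Function.uncurry fun x y ↦ 𝓕 (G y) x) := by
  have : (Function.uncurry fun x y ↦ 𝓕 (G y) x) = fun z : V × Y ↦
      ∫ ξ : V, Complex.exp (↑(-2 * π * inner ℝ ξ z.1) * Complex.I) • G z.2 ξ := by
    ext z
    simp [Function.uncurry, Real.fourier_eq']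
  rw [this]
  refine (StronglyMeasurable.integral_prod_right (ν := volume) (f := fun (z : V × Y) (ξ : V) ↦
    Complex.exp (↑(-2 * π * inner ℝ ξ z.1) * Complex.I) • G z.2 ξ) ?_).measurable
  refine Measurable.stronglyMeasurable ?_
  have h2 : Measurable fun p : (V × Y) × V ↦ G p.1.2 p.2 :=
    hG.comp (by fun_prop : Measurable fun p : (V × Y) × V ↦ (p.1.2, p.2))
  simp only [Function.uncurry_def]
  fun_prop

theorem enorm_fourier_le (G : V → ℂ) (x : V) : ‖𝓕 G x‖ₑ ≤ ∫⁻ ξ, ‖G ξ‖ₑ := by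
  rw [Real.fourier_eq']
  refine (enorm_integral_le_lintegral_enorm _).trans (lintegral_mono fun ξ ↦ ?_)
  rw [enorm_smul, ← ofReal_norm, Complex.norm_exp_ofReal_mul_I]
  simp

theorem enorm_add_sq_le {E : Type*} [SeminormedAddCommGroup E] (u v : E) :
    ‖u + v‖ₑ ^ 2 ≤ 2 * ‖u‖ₑ ^ 2 + 2 * ‖v‖ₑ ^ 2 := by
  have h : ‖u + v‖₊ ^ 2 ≤ 2 * ‖u‖₊ ^ 2 + 2 * ‖v‖₊ ^ 2 := by
    rw [← mul_add]
    exact (pow_le_pow_left' (nnnorm_add_le u v) 2).trans add_sq_le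
  simp only [enorm_eq_nnnorm]
  exact_mod_cast h

theorem lintegral_enorm_add_sq_le {Y E : Type*} [MeasurableSpace Y] [SeminormedAddCommGroup E]
    {ν : Measure Y} {u v : Y → E} (hu : Measurable fun y ↦ ‖u y‖ₑ ^ 2) :
    ∫⁻ y, ‖u y + v y‖ₑ ^ 2 ∂ν ≤ 2 * ∫⁻ y, ‖u y‖ₑ ^ 2 ∂ν + 2 * ∫⁻ y, ‖v y‖ₑ ^ 2 ∂ν := by
  refine (lintegral_mono fun y ↦ enorm_add_sq_le (u y) (v y)).trans ?_
  rw [lintegral_add_left (hu.const_mul 2), lintegral_const_mul' _ _ ENNReal.ofNat_ne_top,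
    lintegral_const_mul' _ _ ENNReal.ofNat_ne_top]

/-- High–low frequency decomposition of a measurable family of Schwartz functions. -/
theorem exists_frequency_decomposition {a : ℝ} (ha0 : 0 < a) (had : a < Module.finrank ℝ V) :
    ∃ K : ℝ, 0 < K ∧ ∀ {Y : Type*} [MeasurableSpace Y] (ν : Measure Y) [SFinite ν]
      (G : Y → 𝓢(V, ℂ)), Measurable (Function.uncurry fun y ξ ↦ G y ξ) → ∀ R : ℝ, 0 < R →
      ∃ Q : V → ℝ≥0∞, Measurable Q ∧
        (∀ x, ∫⁻ y, ‖𝓕 (G y : V → ℂ) x‖ₑ ^ 2 ∂ν ≤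
          2 * (ENNReal.ofReal (K * R ^ (Module.finrank ℝ V - a)) *
            ∫⁻ y, (∫⁻ ξ, ENNReal.ofReal (‖ξ‖ ^ a) * ‖G y ξ‖ₑ ^ 2) ∂ν) + 2 * Q x) ∧
        ∫⁻ x, Q x ≤ ∫⁻ y, (∫⁻ ξ, (Metric.ball (0 : V) R)ᶜ.indicator 1 ξ * ‖G y ξ‖ₑ ^ 2) ∂ν := by
  obtain ⟨K, hK, hKR⟩ := exists_sq_lintegral_ball_enorm_le (V := V) ha0 had
  refine ⟨K * 2 ^ (Module.finrank ℝ V - a), by positivity, fun {Y} _ ν _ G hG R hR ↦ ?_⟩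
  obtain ⟨χ, hχ, hlow, hhigh⟩ := exists_frequency_cutoff (V := V) R hR
  have hχ' : Function.HasTemperateGrowth fun ξ ↦ 1 - χ ξ :=
    (Function.HasTemperateGrowth.const 1).sub hχ
  let G₁ : Y → 𝓢(V, ℂ) := fun y ↦ SchwartzMap.smulLeftCLM ℂ χ (G y)
  let G₂ : Y → 𝓢(V, ℂ) := fun y ↦ SchwartzMap.smulLeftCLM ℂ (fun ξ ↦ 1 - χ ξ) (G y)
  have hG₁ (y ξ) : G₁ y ξ = χ ξ * G y ξ := SchwartzMap.smulLeftCLM_apply_apply hχ _ _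
  have hG₂ (y ξ) : G₂ y ξ = (1 - χ ξ) * G y ξ := SchwartzMap.smulLeftCLM_apply_apply hχ' _ _
  have hadd (y) : G y = G₁ y + G₂ y := by
    ext ξ
    rw [add_apply, hG₁, hG₂]
    ring
  have hG' : Measurable fun z : Y × V ↦ G z.1 z.2 := hG
  have hχm : Measurable χ := hχ.1.continuous.measurable
  have hG₁m : Measurable (Function.uncurry fun y ξ ↦ G₁ y ξ) := by
    simp only [hG₁, Function.uncurry_def]
    fun_prop
  have hG₂m : Measurable (Function.uncurry fun y ξ ↦ G₂ y ξ) := by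
    simp only [hG₂, Function.uncurry_def]
    fun_prop
  have hm₂ : Measurable fun z : V × Y ↦ ‖𝓕 (G₂ z.2 : V → ℂ) z.1‖ₑ ^ 2 :=
    (measurable_uncurry_fourier hG₂m).enorm.pow_const 2
  refine ⟨fun x ↦ ∫⁻ y, ‖𝓕 (G₂ y : V → ℂ) x‖ₑ ^ 2 ∂ν, hm₂.lintegral_prod_right', fun x ↦ ?_, ?_⟩
  · have hQ₁ : ∫⁻ y, ‖𝓕 (G₁ y : V → ℂ) x‖ₑ ^ 2 ∂ν ≤
        ENNReal.ofReal (K * (2 * R) ^ (Module.finrank ℝ V - a)) *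
            ∫⁻ y, (∫⁻ ξ, ENNReal.ofReal (‖ξ‖ ^ a) * ‖G y ξ‖ₑ ^ 2) ∂ν := by
      rw [← lintegral_const_mul' _ _ ENNReal.ofReal_ne_top]
      refine lintegral_mono fun y ↦ ?_
      refine le_trans ?_ (hKR (2 * R) (by positivity) (G y) (G y).continuous.measurable)
      refine pow_le_pow_left' ((enorm_fourier_le _ x).trans ?_) 2
      rw [← lintegral_indicator Metric.isOpen_ball.measurableSet]
      refine lintegral_mono fun ξ ↦ ?_
      rw [hG₁, enorm_mul]
      refine (mul_le_mul_left (hlow ξ) _).trans ?_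
      by_cases h : ξ ∈ Metric.ball (0 : V) (2 * R) <;> simp [h]
    have hfour (y) : 𝓕 (G y : V → ℂ) x = 𝓕 (G₁ y : V → ℂ) x + 𝓕 (G₂ y : V → ℂ) x := by
      simp only [← SchwartzMap.fourier_coe]
      rw [hadd y, FourierTransform.fourier_add, add_apply]
    have hmx : Measurable fun y ↦ ‖𝓕 (G₁ y : V → ℂ) x‖ₑ ^ 2 :=
      (measurable_uncurry_fourier hG₁m).of_uncurry_left.enorm.pow_const 2
    simp only [hfour]
    refine (lintegral_enorm_add_sq_le hmx).trans ?_
    rw [mul_assoc, ← mul_rpow (by positivity) hR.le]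
    exact add_le_add_left (mul_le_mul_right hQ₁ 2) _
  · rw [lintegral_lintegral_swap hm₂.aemeasurable]
    refine lintegral_mono fun y ↦ ?_
    rw [lintegral_enorm_sq_fourier]
    refine lintegral_mono fun ξ ↦ ?_
    rw [hG₂, enorm_mul, mul_pow]
    refine mul_le_mul_left ((pow_le_pow_left' (hhigh ξ) 2).trans ?_) _
    by_cases h : ξ ∈ (Metric.ball (0 : V) R)ᶜ
    · simp only [Set.indicator_of_mem h, Pi.one_apply, one_pow, le_refl]
    · simp only [Set.indicator_of_notMem h]
      simp

theorem lintegral_Ioi_indicator_rpow {r T : ℝ} (hr : 0 < r) (hT : 0 ≤ T) :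
    ∫⁻ t in Set.Ioi (0 : ℝ), (Set.Iic T).indicator 1 t * ENNReal.ofReal (t ^ (r - 1)) =
      ENNReal.ofReal (T ^ r / r) := by
  have hint : IntervalIntegrable (fun t : ℝ ↦ t ^ (r - 1)) volume 0 T :=
    intervalIntegral.intervalIntegrable_rpow' (by linarith)
  have hval : ∫ t in Set.Ioc 0 T, t ^ (r - 1) = T ^ r / r := by
    rw [← intervalIntegral.integral_of_le hT, integral_rpow (.inl (by linarith))]
    simp [hr.ne']
  rw [← hval, ofReal_integral_eq_lintegral_ofReal
    ((intervalIntegrable_iff_integrableOn_Ioc_of_le hT).1 hint)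
    ((ae_restrict_mem measurableSet_Ioc).mono fun t ht ↦ rpow_nonneg ht.1.le _),
    ← Set.Ioi_inter_Iic, Set.inter_comm, ← Measure.restrict_restrict measurableSet_Iic,
    ← lintegral_indicator measurableSet_Iic]
  refine lintegral_congr fun t ↦ ?_
  by_cases h : t ∈ Set.Iic T <;> simp [h]

/-- A weak-type bound whose right-hand side is itself a superlevel integral upgrades to a strong
bound by the layer cake formula. -/
theorem lintegral_rpow_le_of_measure_lt_le {X Z : Type*} [MeasurableSpace X] [MeasurableSpace Z]
    {μ : Measure X} {ρ : Measure Z} [SFinite ρ] {Q : X → ℝ≥0∞} {g : Z → ℝ≥0∞} {T : Z → ℝ}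
    {q b : ℝ} (hq : 1 < q) (hQ : Measurable Q) (hQtop : ∀ᵐ x ∂μ, Q x < ∞) (hg : Measurable g)
    (hT : Measurable T) (hT0 : ∀ z, 0 ≤ T z) (hb : 0 ≤ b)
    (h : ∀ t : ℝ, 0 < t → μ {x | ENNReal.ofReal t < Q x} ≤
      ENNReal.ofReal (b / t) * ∫⁻ z, (Set.Iic (T z)).indicator 1 t * g z ∂ρ) :
    ∫⁻ x, Q x ^ q ∂μ ≤
      ENNReal.ofReal (q * b / (q - 1)) * ∫⁻ z, ENNReal.ofReal (T z ^ (q - 1)) * g z ∂ρ := by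
  have hind : Measurable fun p : ℝ × Z ↦ (Set.Iic (T p.2)).indicator (1 : ℝ → ℝ≥0∞) p.1 := by
    have : (fun p : ℝ × Z ↦ (Set.Iic (T p.2)).indicator (1 : ℝ → ℝ≥0∞) p.1) =
        {p : ℝ × Z | p.1 ≤ T p.2}.indicator 1 := by
      ext p
      simp [Set.indicator]
    rw [this]
    exact measurable_one.indicator (measurableSet_le (by fun_prop) (by fun_prop))
  calc ∫⁻ x, Q x ^ q ∂μ = ∫⁻ x, ENNReal.ofReal ((Q x).toReal ^ q) ∂μ := by
        refine lintegral_congr_ae (hQtop.mono fun x hx ↦ ?_)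
        dsimp only
        rw [← ENNReal.ofReal_rpow_of_nonneg ENNReal.toReal_nonneg (by linarith),
          ENNReal.ofReal_toReal hx.ne]
    _ = ENNReal.ofReal q * ∫⁻ t in Set.Ioi 0, μ {x | t < (Q x).toReal} *
          ENNReal.ofReal (t ^ (q - 1)) :=
        lintegral_rpow_eq_lintegral_meas_lt_mul μ (.of_forall fun _ ↦ ENNReal.toReal_nonneg)
          hQ.ennreal_toReal.aemeasurable (by linarith)
    _ ≤ ENNReal.ofReal q * ∫⁻ t in Set.Ioi (0 : ℝ), (∫⁻ z, ENNReal.ofReal b *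
          ((Set.Iic (T z)).indicator 1 t * ENNReal.ofReal (t ^ (q - 1 - 1)) * g z) ∂ρ) := by
        refine mul_le_mul_right (setLIntegral_mono' measurableSet_Ioi fun t (ht : 0 < t) ↦ ?_) _
        have hsub : {x | t < (Q x).toReal} ⊆ {x | ENNReal.ofReal t < Q x} := fun x hx ↦
          (ENNReal.ofReal_lt_ofReal_iff_of_nonneg ht.le).2 hx |>.trans_le ENNReal.ofReal_toReal_le
        refine (mul_le_mul_left ((measure_mono hsub).trans (h t ht)) _).trans ?_
        have hpow : ENNReal.ofReal (b / t) * ENNReal.ofReal (t ^ (q - 1)) =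
            ENNReal.ofReal b * ENNReal.ofReal (t ^ (q - 1 - 1)) := by
          rw [← ENNReal.ofReal_mul (by positivity), ← ENNReal.ofReal_mul hb,
            rpow_sub_one ht.ne' (q - 1)]
          congr 1
          ring
        rw [mul_right_comm, hpow, ← lintegral_const_mul' _ _ (by finiteness)]
        refine lintegral_mono fun z ↦ le_of_eq ?_
        ring
    _ = ENNReal.ofReal q * ∫⁻ z, (∫⁻ t in Set.Ioi (0 : ℝ), ENNReal.ofReal b *
          ((Set.Iic (T z)).indicator 1 t * ENNReal.ofReal (t ^ (q - 1 - 1)) * g z)) ∂ρ := by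
        rw [lintegral_lintegral_swap]
        refine Measurable.aemeasurable ?_
        simp only [Function.uncurry_def]
        fun_prop
    _ = _ := by
        rw [← lintegral_const_mul' _ _ ENNReal.ofReal_ne_top,
          ← lintegral_const_mul' _ _ ENNReal.ofReal_ne_top]
        refine lintegral_congr fun z ↦ ?_
        have hm : Measurable fun t : ℝ ↦
            (Set.Iic (T z)).indicator (1 : ℝ → ℝ≥0∞) t * ENNReal.ofReal (t ^ (q - 1 - 1)) :=
          (measurable_one.indicator measurableSet_Iic).mul (by fun_prop)
        rw [lintegral_const_mul' _ _ ENNReal.ofReal_ne_top, lintegral_mul_const _ hm,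
          lintegral_Ioi_indicator_rpow (by linarith) (hT0 z), ← mul_assoc, ← mul_assoc,
          ← mul_assoc, ← ENNReal.ofReal_mul (by linarith), ← ENNReal.ofReal_mul (by positivity),
          ← ENNReal.ofReal_mul (by have : 0 < q - 1 := by linarith
                                   positivity)]
        congr 2
        ring

theorem exists_lintegral_rpow_le_of_le {a : ℝ} (ha0 : 0 < a) (had : a < Module.finrank ℝ V) :
    ∃ c : ℝ, 0 < c ∧ ∀ {Y : Type*} [MeasurableSpace Y] (ν : Measure Y) [SFinite ν]
      (G : Y → 𝓢(V, ℂ)), Measurable (Function.uncurry fun y ξ ↦ G y ξ) → ∀ M : ℝ, 0 < M →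
      ∫⁻ y, (∫⁻ ξ, ENNReal.ofReal (‖ξ‖ ^ a) * ‖G y ξ‖ₑ ^ 2) ∂ν ≤ ENNReal.ofReal M →
      ∫⁻ x, (∫⁻ y, ‖𝓕 (G y : V → ℂ) x‖ₑ ^ 2 ∂ν) ^
          ((Module.finrank ℝ V : ℝ) / (Module.finrank ℝ V - a)) ≤
        ENNReal.ofReal
          (c * M ^ ((Module.finrank ℝ V : ℝ) / (Module.finrank ℝ V - a))) := by
  obtain ⟨K, hK, hdec⟩ := exists_frequency_decomposition (V := V) ha0 had
  set s : ℝ := Module.finrank ℝ V - a with hs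
  have hs0 : 0 < s := by linarith
  set q : ℝ := (Module.finrank ℝ V : ℝ) / s with hq
  have hq1 : q - 1 = a / s := by rw [hq, div_sub_one hs0.ne', hs]; ring
  have hq1' : 0 < q - 1 := hq1 ▸ by positivity
  have hq0 : 0 < q := by linarith
  refine ⟨q * 4 / (q - 1) * (4 * K) ^ (q - 1), by positivity,
    fun {Y} _ ν _ G hG M hM hS ↦ ?_⟩
  have hFm : Measurable fun x ↦ ∫⁻ y, ‖𝓕 (G y : V → ℂ) x‖ₑ ^ 2 ∂ν :=
    ((measurable_uncurry_fourier hG).enorm.pow_const 2).lintegral_prod_right'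
  have hG' : Measurable fun z : Y × V ↦ G z.1 z.2 := hG
  have hbound (R : ℝ) (hR : 0 < R) :
      ∫⁻ y, (∫⁻ ξ, (Metric.ball (0 : V) R)ᶜ.indicator 1 ξ * ‖G y ξ‖ₑ ^ 2) ∂ν < ∞ := by
    have hle : ∫⁻ y, (∫⁻ ξ, (Metric.ball (0 : V) R)ᶜ.indicator 1 ξ * ‖G y ξ‖ₑ ^ 2) ∂ν ≤
        ENNReal.ofReal (R ^ (-a)) *
          ∫⁻ y, (∫⁻ ξ, ENNReal.ofReal (‖ξ‖ ^ a) * ‖G y ξ‖ₑ ^ 2) ∂ν := by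
      rw [← lintegral_const_mul' _ _ ENNReal.ofReal_ne_top]
      refine lintegral_mono fun y ↦ ?_
      rw [← lintegral_const_mul' _ _ ENNReal.ofReal_ne_top]
      refine lintegral_mono fun ξ ↦ ?_
      rw [← mul_assoc, ← ENNReal.ofReal_mul (by positivity)]
      refine mul_le_mul_left ?_ _
      by_cases h : ξ ∈ (Metric.ball (0 : V) R)ᶜ
      · rw [Set.indicator_of_mem h, Pi.one_apply, ENNReal.one_le_ofReal, rpow_neg hR.le,
          ← div_eq_inv_mul, one_le_div (by positivity)]
        have : R ≤ ‖ξ‖ := by simpa using h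
        gcongr
      · rw [Set.indicator_of_notMem h]
        simp
    exact hle.trans_lt (ENNReal.mul_lt_top ENNReal.ofReal_lt_top
      (hS.trans_lt ENNReal.ofReal_lt_top))
  have hlow (R : ℝ) (hR : 0 < R) : ENNReal.ofReal (K * R ^ s) *
      ∫⁻ y, (∫⁻ ξ, ENNReal.ofReal (‖ξ‖ ^ a) * ‖G y ξ‖ₑ ^ 2) ∂ν ≤
        ENNReal.ofReal (K * R ^ s * M) := by
    rw [ENNReal.ofReal_mul (p := K * R ^ s) (by positivity)]
    exact mul_le_mul_right hS _
  have htop : ∀ᵐ x, ∫⁻ y, ‖𝓕 (G y : V → ℂ) x‖ₑ ^ 2 ∂ν < ∞ := by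
    obtain ⟨Q, hQm, hQ, hQint⟩ := hdec ν G hG 1 one_pos
    filter_upwards [ae_lt_top hQm (hQint.trans_lt (hbound 1 one_pos)).ne] with x hx
    refine (hQ x).trans_lt (ENNReal.add_lt_top.2 ⟨?_, ?_⟩)
    · exact ENNReal.mul_lt_top (by simp) ((hlow 1 one_pos).trans_lt ENNReal.ofReal_lt_top)
    · exact ENNReal.mul_lt_top (by simp) hx
  have hlevel (t : ℝ) (ht : 0 < t) :
      volume {x | ENNReal.ofReal t < ∫⁻ y, ‖𝓕 (G y : V → ℂ) x‖ₑ ^ 2 ∂ν} ≤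
        ENNReal.ofReal (4 / t) * ∫⁻ z : Y × V, (Set.Iic (4 * K * M * ‖z.2‖ ^ s)).indicator 1 t *
          ‖G z.1 z.2‖ₑ ^ 2 ∂(ν.prod volume) := by
    set R : ℝ := (t / (4 * K * M)) ^ s⁻¹ with hRdef
    have hR : 0 < R := by positivity
    have hRs : R ^ s = t / (4 * K * M) := rpow_inv_rpow (by positivity) hs0.ne'
    obtain ⟨Q, hQm, hQ, hQint⟩ := hdec ν G hG R hR
    have hsub : {x | ENNReal.ofReal t < ∫⁻ y, ‖𝓕 (G y : V → ℂ) x‖ₑ ^ 2 ∂ν} ⊆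
        {x | ENNReal.ofReal (t / 4) ≤ Q x} := by
      intro x hx
      by_contra hcon
      have hcon' : Q x ≤ ENNReal.ofReal (t / 4) := (not_le.1 hcon).le
      have h₁ : K * R ^ s * M = t / 4 := by
        rw [hRs]
        field_simp
      refine (lt_of_lt_of_le hx (hQ x)).not_ge ?_
      have h₂ := hlow R hR
      rw [h₁] at h₂
      calc _ ≤ 2 * ENNReal.ofReal (t / 4) + 2 * ENNReal.ofReal (t / 4) := by gcongr
        _ = ENNReal.ofReal t := by
          rw [← add_mul, show t = 4 * (t / 4) by ring, ENNReal.ofReal_mul (by norm_num)]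
          norm_num
    refine (measure_mono hsub).trans ((meas_ge_le_lintegral_div hQm.aemeasurable
      (by simpa using ht) ENNReal.ofReal_ne_top).trans ?_)
    rw [ENNReal.div_eq_inv_mul, ← ENNReal.ofReal_inv_of_pos (by positivity), inv_div]
    refine mul_le_mul_right (hQint.trans (le_of_eq ?_)) _
    rw [lintegral_prod]
    · refine lintegral_congr fun y ↦ lintegral_congr fun ξ ↦ ?_
      congr 1
      have hiff : ξ ∈ (Metric.ball (0 : V) R)ᶜ ↔ t ∈ Set.Iic (4 * K * M * ‖ξ‖ ^ s) := by
        rw [Set.mem_Iic, ← div_le_iff₀' (by positivity), ← hRs,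
          rpow_le_rpow_iff hR.le (norm_nonneg _) hs0]
        simp
      by_cases h : ξ ∈ (Metric.ball (0 : V) R)ᶜ
      · rw [Set.indicator_of_mem h, Set.indicator_of_mem (hiff.1 h)]; rfl
      · rw [Set.indicator_of_notMem h, Set.indicator_of_notMem (hiff.not.1 h)]
    · refine Measurable.aemeasurable (Measurable.mul ?_ (by fun_prop))
      have : (fun z : Y × V ↦ (Set.Iic (4 * K * M * ‖z.2‖ ^ s)).indicator (1 : ℝ → ℝ≥0∞) t) =
          {z : Y × V | t ≤ 4 * K * M * ‖z.2‖ ^ s}.indicator 1 := by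
        ext z
        simp [Set.indicator]
      rw [this]
      exact measurable_one.indicator (measurableSet_le (by fun_prop) (by fun_prop))
  refine (lintegral_rpow_le_of_measure_lt_le (ρ := ν.prod volume)
    (g := fun z : Y × V ↦ ‖G z.1 z.2‖ₑ ^ 2) (T := fun z ↦ 4 * K * M * ‖z.2‖ ^ s)
    (by linarith) hFm htop (by fun_prop) (by fun_prop) (fun z ↦ by positivity) (by norm_num)
    hlevel).trans ?_
  have hT (z : Y × V) : ENNReal.ofReal ((4 * K * M * ‖z.2‖ ^ s) ^ (q - 1)) * ‖G z.1 z.2‖ₑ ^ 2 =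
      ENNReal.ofReal ((4 * K * M) ^ (q - 1)) *
        (ENNReal.ofReal (‖z.2‖ ^ a) * ‖G z.1 z.2‖ₑ ^ 2) := by
    rw [← mul_assoc, ← ENNReal.ofReal_mul (by positivity), mul_rpow (by positivity) (by positivity),
      ← rpow_mul (norm_nonneg _), hq1, mul_div_cancel₀ _ hs0.ne']
  simp only [hT]
  rw [lintegral_const_mul' _ _ ENNReal.ofReal_ne_top, lintegral_prod _ (by fun_prop)]
  calc _ ≤ ENNReal.ofReal (q * 4 / (q - 1)) * (ENNReal.ofReal ((4 * K * M) ^ (q - 1)) *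
        ENNReal.ofReal M) := by gcongr
    _ = _ := by
      rw [← ENNReal.ofReal_mul (by positivity), ← ENNReal.ofReal_mul (by positivity),
        mul_rpow (by positivity) hM.le]
      congr 1
      rw [← sub_add_cancel q 1, rpow_add_one hM.ne', sub_add_cancel]
      ring

/-- Vector-valued Sobolev embedding `Ḣ^{a/2} ⊆ L^{2d/(d-a)}` for functions with values in `L²(ν)`,
stated on the frequency side. -/
theorem exists_lintegral_rpow_le {a : ℝ} (ha0 : 0 < a) (had : a < Module.finrank ℝ V) :
    ∃ C : ℝ≥0∞, C ≠ ∞ ∧ ∀ {Y : Type*} [MeasurableSpace Y] (ν : Measure Y) [SFinite ν]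
      (G : Y → 𝓢(V, ℂ)), Measurable (Function.uncurry fun y ξ ↦ G y ξ) →
      ∫⁻ x, (∫⁻ y, ‖𝓕 (G y : V → ℂ) x‖ₑ ^ 2 ∂ν) ^
          ((Module.finrank ℝ V : ℝ) / (Module.finrank ℝ V - a)) ≤
        C * (∫⁻ y, (∫⁻ ξ, ENNReal.ofReal (‖ξ‖ ^ a) * ‖G y ξ‖ₑ ^ 2) ∂ν) ^
          ((Module.finrank ℝ V : ℝ) / (Module.finrank ℝ V - a)) := by
  obtain ⟨c, hc, h⟩ := exists_lintegral_rpow_le_of_le (V := V) ha0 had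
  have hq : 0 < (Module.finrank ℝ V : ℝ) / (Module.finrank ℝ V - a) :=
    div_pos (by linarith) (by linarith)
  refine ⟨ENNReal.ofReal c, ENNReal.ofReal_ne_top, fun {Y} _ ν _ G hG ↦ ?_⟩
  have h' := h ν G hG
  generalize ∫⁻ y, (∫⁻ ξ, ENNReal.ofReal (‖ξ‖ ^ a) * ‖G y ξ‖ₑ ^ 2) ∂ν = S at h' ⊢
  generalize (Module.finrank ℝ V : ℝ) / (Module.finrank ℝ V - a) = q at *
  rcases eq_or_ne S ∞ with rfl | hS
  · rw [ENNReal.top_rpow_of_pos hq, ENNReal.mul_top (by simpa using hc)]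
    exact le_top
  have hlim : Filter.Tendsto (fun M : ℝ ↦ ENNReal.ofReal (c * M ^ q))
      (nhdsWithin S.toReal (Set.Ioi S.toReal)) (nhds (ENNReal.ofReal (c * S.toReal ^ q))) := by
    refine (ENNReal.continuous_ofReal.tendsto _).comp (Filter.Tendsto.const_mul c ?_)
    exact (continuousAt_rpow_const _ _ (.inr hq.le)).tendsto.mono_left nhdsWithin_le_nhds
  have hle := ge_of_tendsto hlim (eventually_mem_nhdsWithin.mono fun M (hM : S.toReal < M) ↦
    h' M (ENNReal.toReal_nonneg.trans_lt hM) ((ENNReal.le_ofReal_iff_toReal_le hS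
      (ENNReal.toReal_nonneg.trans hM.le)).2 hM.le))
  rwa [ENNReal.ofReal_mul hc.le, ← ENNReal.ofReal_rpow_of_nonneg ENNReal.toReal_nonneg hq.le,
    ENNReal.ofReal_toReal hS] at hle

end Sobolev

section Slices

variable {V : Type*} [NormedAddCommGroup V]

theorem norm_le_norm_finCons_left {m : ℕ} (x : V) (y : Fin m → V) :
    ‖x‖ ≤ ‖(Fin.cons x y : Fin (m + 1) → V)‖ := by
  simpa using norm_le_pi_norm (Fin.cons x y : Fin (m + 1) → V) 0

theorem norm_le_norm_finCons_right {m : ℕ} (x : V) (y : Fin m → V) :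
    ‖y‖ ≤ ‖(Fin.cons x y : Fin (m + 1) → V)‖ :=
  (pi_norm_le_iff_of_nonneg (norm_nonneg _)).2 fun i ↦ by
    simpa using norm_le_pi_norm (Fin.cons x y : Fin (m + 1) → V) i.succ

theorem continuous_finCons {m : ℕ} :
    Continuous fun z : V × (Fin m → V) ↦ (Fin.cons z.1 z.2 : Fin (m + 1) → V) :=
  continuous_pi fun k ↦ by
    refine Fin.cases ?_ (fun i ↦ ?_) k
    · simpa using continuous_fst
    · simpa [Function.comp_def] using (continuous_apply i).comp continuous_snd

variable [NormedSpace ℝ V]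

theorem hasTemperateGrowth_finCons_left {m : ℕ} (y : Fin m → V) :
    Function.HasTemperateGrowth fun x : V ↦ (Fin.cons x y : Fin (m + 1) → V) := by
  have h : (fun x : V ↦ (Fin.cons x y : Fin (m + 1) → V)) =
      fun x ↦ ContinuousLinearMap.single ℝ (fun _ : Fin (m + 1) ↦ V) 0 x + Fin.cons 0 y := by
    ext x k
    refine Fin.cases ?_ (fun i ↦ ?_) k <;> simp
  rw [h]
  exact (ContinuousLinearMap.hasTemperateGrowth _).add (.const _)

theorem hasTemperateGrowth_finCons_right {m : ℕ} (x : V) :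
    Function.HasTemperateGrowth fun y : Fin m → V ↦ (Fin.cons x y : Fin (m + 1) → V) := by
  let L : (Fin m → V) →L[ℝ] (Fin (m + 1) → V) :=
    ContinuousLinearMap.pi (Fin.cons 0 fun i ↦ ContinuousLinearMap.proj i)
  have h : (fun y : Fin m → V ↦ (Fin.cons x y : Fin (m + 1) → V)) =
      fun y ↦ L y + Fin.cons x 0 := by
    ext y k
    refine Fin.cases ?_ (fun i ↦ ?_) k <;> simp [L]
  rw [h]
  exact (ContinuousLinearMap.hasTemperateGrowth _).add (.const _)

/-- Restriction of a Schwartz function on `Vᵐ⁺¹` to the first variable. -/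
noncomputable def SchwartzMap.headSlice {m : ℕ} (f : 𝓢(Fin (m + 1) → V, ℂ)) (y : Fin m → V) :
    𝓢(V, ℂ) :=
  SchwartzMap.compCLM ℂ (hasTemperateGrowth_finCons_left y)
    ⟨1, 1, fun x ↦ by linarith [norm_le_norm_finCons_left x y]⟩ f

/-- Restriction of a Schwartz function on `Vᵐ⁺¹` to all but the first variable. -/
noncomputable def SchwartzMap.tailSlice {m : ℕ} (f : 𝓢(Fin (m + 1) → V, ℂ)) (x : V) :
    𝓢(Fin m → V, ℂ) :=
  SchwartzMap.compCLM ℂ (hasTemperateGrowth_finCons_right x)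
    ⟨1, 1, fun y ↦ by linarith [norm_le_norm_finCons_right x y]⟩ f

@[simp]
theorem SchwartzMap.headSlice_apply {m : ℕ} (f : 𝓢(Fin (m + 1) → V, ℂ)) (y : Fin m → V) (x : V) :
    f.headSlice y x = f (Fin.cons x y) := rfl

@[simp]
theorem SchwartzMap.tailSlice_apply {m : ℕ} (f : 𝓢(Fin (m + 1) → V, ℂ)) (x : V) (y : Fin m → V) :
    f.tailSlice x y = f (Fin.cons x y) := rfl

end Slices

section Multilinear

variable {V : Type*} [NormedAddCommGroup V] [InnerProductSpace ℝ V] [FiniteDimensional ℝ V]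
  [MeasurableSpace V] [BorelSpace V]

/-- The Fourier transform on `Vᵐ` with kernel `exp (2πi ∑ ⟪ξₖ, xₖ⟫)`. -/
noncomputable def multiFourier {m : ℕ} (f : (Fin m → V) → ℂ) (ξ : Fin m → V) : ℂ :=
  ∫ x : Fin m → V, Complex.exp (2 * π * Complex.I * ((∑ k, ⟪ξ k, x k⟫ : ℝ) : ℂ)) * f x

theorem norm_exp_two_pi_mul_I_mul (t : ℝ) :
    ‖Complex.exp (2 * π * Complex.I * (t : ℂ))‖ = 1 := by
  rw [show 2 * π * Complex.I * (t : ℂ) = ((2 * π * t : ℝ) : ℂ) * Complex.I by push_cast; ring,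
    Complex.norm_exp_ofReal_mul_I]

theorem exists_schwartz_eq_multiFourier {m : ℕ} (f : 𝓢(Fin m → V, ℂ)) :
    ∃ g : 𝓢(Fin m → V, ℂ), ∀ ξ, g ξ = multiFourier f ξ := by
  let e : PiLp 2 (fun _ : Fin m ↦ V) ≃L[ℝ] (Fin m → V) :=
    PiLp.continuousLinearEquiv 2 ℝ (fun _ : Fin m ↦ V)
  let μ : Measure (PiLp 2 (fun _ : Fin m ↦ V)) := (volume : Measure (Fin m → V)).map e.symm
  have hμ : μ.IsAddHaarMeasure := e.symm.isAddHaarMeasure_map volume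
  let c := μ.addHaarScalarFactor volume
  have hc : μ = c • volume := Measure.isAddLeftInvariant_eq_smul μ volume
  let F : 𝓢(PiLp 2 (fun _ : Fin m ↦ V), ℂ) :=
    SchwartzMap.compCLMOfContinuousLinearEquiv ℂ e f
  refine ⟨(c : ℂ) • SchwartzMap.compCLMOfContinuousLinearEquiv ℂ e.symm (𝓕⁻ F), fun ξ ↦ ?_⟩
  have h : ∀ H : PiLp 2 (fun _ : Fin m ↦ V) → ℂ, ∫ x, H (e.symm x) = (c : ℂ) * ∫ w, H w := by
    intro H
    have h₁ : ∫ w, H w ∂μ = ∫ x, H (e.symm x) :=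
      e.symm.toHomeomorph.measurableEmbedding.integral_map _
    rw [← h₁, hc, integral_smul_nnreal_measure]
    simp [NNReal.smul_def]
  rw [smul_apply, SchwartzMap.compCLMOfContinuousLinearEquiv_apply, smul_eq_mul,
    Function.comp_apply, SchwartzMap.fourierInv_coe, Real.fourierInv_eq', ← h]
  refine integral_congr_ae (.of_forall fun x ↦ ?_)
  have hin : (inner ℝ (e.symm x) (e.symm ξ) : ℝ) = ∑ k, ⟪ξ k, x k⟫ := by
    rw [PiLp.inner_apply]
    exact Finset.sum_congr rfl fun k _ ↦ real_inner_comm _ _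
  dsimp only
  rw [hin, smul_eq_mul]
  have hF : F (e.symm x) = f x := rfl
  rw [hF]
  congr 2
  push_cast
  ring

theorem measurePreserving_finCons (m : ℕ) :
    MeasurePreserving (MeasurableEquiv.piFinSuccAbove (fun _ : Fin (m + 1) ↦ V) 0).symm
      (volume.prod volume) volume :=
  (volume_preserving_piFinSuccAbove (fun _ : Fin (m + 1) ↦ V) 0).symm _

theorem lintegral_finCons {m : ℕ} {F : (Fin (m + 1) → V) → ℝ≥0∞} (hF : Measurable F) :
    ∫⁻ x, F x = ∫⁻ z : V × (Fin m → V), F (Fin.cons z.1 z.2) ∂(volume.prod volume) := by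
  rw [← (measurePreserving_finCons m).lintegral_comp hF]
  simp [MeasurableEquiv.piFinSuccAbove, Fin.consEquiv]

theorem integral_finCons {m : ℕ} (F : (Fin (m + 1) → V) → ℂ) :
    ∫ x, F x = ∫ z : V × (Fin m → V), F (Fin.cons z.1 z.2) ∂(volume.prod volume) := by
  rw [← (measurePreserving_finCons m).integral_comp (MeasurableEquiv.measurableEmbedding _)]
  simp [MeasurableEquiv.piFinSuccAbove, Fin.consEquiv]

theorem integrable_finCons {m : ℕ} {F : (Fin (m + 1) → V) → ℂ} (hF : Integrable F) :
    Integrable (fun z : V × (Fin m → V) ↦ F (Fin.cons z.1 z.2)) (volume.prod volume) := by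
  have := (measurePreserving_finCons m).integrable_comp_of_integrable hF
  simpa [MeasurableEquiv.piFinSuccAbove, Fin.consEquiv, Function.comp_def] using this

theorem exists_integrable_bound_tailSlice {m : ℕ} (f : 𝓢(Fin (m + 1) → V, ℂ)) :
    ∃ b : (Fin m → V) → ℝ, Integrable b ∧ ∀ x y, ‖f (Fin.cons x y)‖ ≤ b y := by
  let N := Module.finrank ℝ (Fin m → V) + 1
  refine ⟨fun y ↦ 2 ^ N * (Finset.Iic (N, 0)).sup (fun k ↦ SchwartzMap.seminorm ℂ k.1 k.2) f *
    (1 + ‖y‖) ^ (-(N : ℝ)), (integrable_one_add_norm (by simp [N])).const_mul _, fun x y ↦ ?_⟩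
  have h := SchwartzMap.one_add_le_sup_seminorm_apply (𝕜 := ℂ) (m := (N, 0)) le_rfl le_rfl f
    (Fin.cons x y)
  rw [norm_iteratedFDeriv_zero] at h
  dsimp only
  rw [rpow_neg (by positivity), rpow_natCast, ← div_eq_mul_inv, le_div_iff₀' (by positivity)]
  refine le_trans ?_ h
  gcongr
  exact norm_le_norm_finCons_right x y

theorem continuous_multiFourier_tailSlice {m : ℕ} (f : 𝓢(Fin (m + 1) → V, ℂ)) (η : Fin m → V) :
    Continuous fun x ↦ multiFourier (f.tailSlice x) η := by
  obtain ⟨b, hb, hfb⟩ := exists_integrable_bound_tailSlice f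
  refine continuous_of_dominated (fun x ↦ ?_) (fun x ↦ .of_forall fun y ↦ ?_) hb
    (.of_forall fun y ↦ ?_)
  · exact (Continuous.mul (by fun_prop) (f.tailSlice x).continuous).aestronglyMeasurable
  · rw [norm_mul, norm_exp_two_pi_mul_I_mul, one_mul]
    exact hfb x y
  · exact continuous_const.mul (f.headSlice y).continuous

theorem integrable_exp_mul_finCons {m : ℕ} (f : 𝓢(Fin (m + 1) → V, ℂ)) (η : Fin m → V) :
    Integrable (fun z : V × (Fin m → V) ↦
      Complex.exp (2 * π * Complex.I * ((∑ k, ⟪η k, z.2 k⟫ : ℝ) : ℂ)) * f (Fin.cons z.1 z.2))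
      (volume.prod volume) := by
  refine (integrable_finCons (f.integrable (μ := volume))).bdd_mul (c := 1)
    (Continuous.aestronglyMeasurable (by fun_prop)) (.of_forall fun z ↦ ?_)
  rw [norm_exp_two_pi_mul_I_mul]

theorem multiFourier_finCons {m : ℕ} (f : 𝓢(Fin (m + 1) → V, ℂ)) (ξ : V) (η : Fin m → V) :
    multiFourier f (Fin.cons ξ η) = 𝓕⁻ (fun x ↦ multiFourier (f.tailSlice x) η) ξ := by
  have hint : Integrable (fun z : V × (Fin m → V) ↦
      Complex.exp (2 * π * Complex.I * ((⟪ξ, z.1⟫ : ℝ) : ℂ)) *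
      (Complex.exp (2 * π * Complex.I * ((∑ k, ⟪η k, z.2 k⟫ : ℝ) : ℂ)) * f (Fin.cons z.1 z.2)))
      (volume.prod volume) := by
    refine (integrable_exp_mul_finCons f η).bdd_mul (c := 1)
      (Continuous.aestronglyMeasurable (by fun_prop)) (.of_forall fun z ↦ ?_)
    rw [norm_exp_two_pi_mul_I_mul]
  rw [multiFourier, integral_finCons, Real.fourierInv_eq']
  calc _ = _ := integral_congr_ae (.of_forall fun z ↦ ?_)
    _ = _ := integral_prod _ hint
    _ = _ := integral_congr_ae (.of_forall fun x ↦ ?_)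
  · rw [← mul_assoc, ← Complex.exp_add, Fin.sum_univ_succ]
    simp only [Fin.cons_zero, Fin.cons_succ]
    congr 2
    push_cast
    ring
  · dsimp only
    rw [integral_const_mul, smul_eq_mul, multiFourier, real_inner_comm]
    congr 2
    push_cast
    ring

theorem fourier_headSlice {m : ℕ} {f g : 𝓢(Fin (m + 1) → V, ℂ)}
    (hg : ∀ ξ, g ξ = multiFourier f ξ) (x : V) (η : Fin m → V) :
    𝓕 (g.headSlice η : V → ℂ) x = multiFourier (f.tailSlice x) η := by
  have hinv : 𝓕⁻ (fun x ↦ multiFourier (f.tailSlice x) η) = (g.headSlice η : V → ℂ) := by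
    ext ξ
    rw [← multiFourier_finCons, SchwartzMap.headSlice_apply, hg]
  have hint : Integrable fun x ↦ multiFourier (f.tailSlice x) η :=
    (integrable_exp_mul_finCons f η).integral_prod_left
  have hF : Integrable (𝓕 fun x ↦ multiFourier (f.tailSlice x) η) := by
    have := (g.headSlice η).integrable (μ := volume)
    rw [← hinv] at this
    have h2 := this.comp_neg
    refine h2.congr (.of_forall fun ξ ↦ ?_)
    simp [Real.fourierInv_eq_fourier_neg]
  rw [← hinv, (continuous_multiFourier_tailSlice f η).fourier_fourierInv_eq hint hF]

theorem exists_lintegral_rpow_le_multiFourier {a : ℝ} (ha0 : 0 < a)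
    (had : a < Module.finrank ℝ V) (m : ℕ) :
    ∃ C : ℝ≥0∞, C ≠ ∞ ∧ ∀ f : 𝓢(Fin m → V, ℂ),
      ∫⁻ x, ‖f x‖ₑ ^ (2 * ((Module.finrank ℝ V : ℝ) / (Module.finrank ℝ V - a))) ≤
        C * (∫⁻ ξ, ENNReal.ofReal (∏ k, ‖ξ k‖ ^ a) * ‖multiFourier f ξ‖ₑ ^ 2) ^
          ((Module.finrank ℝ V : ℝ) / (Module.finrank ℝ V - a)) := by
  have hq : 0 < (Module.finrank ℝ V : ℝ) / (Module.finrank ℝ V - a) :=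
    div_pos (by linarith) (by linarith)
  obtain ⟨C₁, hC₁, h₁⟩ := exists_lintegral_rpow_le (V := V) ha0 had
  generalize (Module.finrank ℝ V : ℝ) / (Module.finrank ℝ V - a) = q at *
  induction m with
  | zero =>
    refine ⟨1, by simp, fun f ↦ ?_⟩
    have hv : (volume : Measure (Fin 0 → V)) = Measure.dirac default := by
      rw [volume_pi, Measure.pi_of_empty]
      congr 1
    simp [multiFourier, hv, ENNReal.rpow_mul]
  | succ m ih =>
    obtain ⟨C, hC, h⟩ := ih
    refine ⟨C * C₁, ENNReal.mul_ne_top hC hC₁, fun f ↦ ?_⟩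
    obtain ⟨g, hg⟩ := exists_schwartz_eq_multiFourier f
    have hgm : Measurable fun z : V × (Fin m → V) ↦ g (Fin.cons z.1 z.2) :=
      (g.continuous.comp continuous_finCons).measurable
    have hfm : Measurable fun z : V × (Fin m → V) ↦ f (Fin.cons z.1 z.2) :=
      (f.continuous.comp continuous_finCons).measurable
    have hw : Measurable fun η : Fin m → V ↦ ENNReal.ofReal (∏ k, ‖η k‖ ^ a) := by fun_prop
    let ν : Measure (Fin m → V) := volume.withDensity fun η ↦ ENNReal.ofReal (∏ k, ‖η k‖ ^ a)
    have hslice : Measurable (Function.uncurry fun (η : Fin m → V) ξ ↦ g.headSlice η ξ) :=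
      hgm.comp measurable_swap
    have hFT (x : V) : ∫⁻ η, ENNReal.ofReal (∏ k, ‖η k‖ ^ a) *
        ‖multiFourier (f.tailSlice x) η‖ₑ ^ 2 =
          ∫⁻ η, ‖𝓕 (g.headSlice η : V → ℂ) x‖ₑ ^ 2 ∂ν := by
      rw [lintegral_withDensity_eq_lintegral_mul _ hw]
      · simp only [Pi.mul_apply, fourier_headSlice hg]
      · exact ((measurable_uncurry_fourier hslice).of_uncurry_left).enorm.pow_const 2
    calc ∫⁻ x, ‖f x‖ₑ ^ (2 * q) = ∫⁻ x, ∫⁻ y, ‖f.tailSlice x y‖ₑ ^ (2 * q) := by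
          rw [lintegral_finCons (by fun_prop), lintegral_prod _ (by fun_prop)]
          rfl
      _ ≤ ∫⁻ x, C * (∫⁻ η, ‖𝓕 (g.headSlice η : V → ℂ) x‖ₑ ^ 2 ∂ν) ^ q :=
          lintegral_mono fun x ↦ (h (f.tailSlice x)).trans_eq (by rw [hFT])
      _ ≤ C * (C₁ * (∫⁻ η, (∫⁻ ξ, ENNReal.ofReal (‖ξ‖ ^ a) * ‖g.headSlice η ξ‖ₑ ^ 2) ∂ν) ^ q) := by
          rw [lintegral_const_mul' _ _ hC]
          exact mul_le_mul_right (h₁ ν g.headSlice hslice) _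
      _ = _ := by
          rw [← mul_assoc]
          congr 2
          simp only [← hg]
          rw [lintegral_withDensity_eq_lintegral_mul _ hw, lintegral_finCons (by fun_prop),
            lintegral_prod_symm _ (by fun_prop)]
          · refine lintegral_congr fun η ↦ ?_
            rw [Pi.mul_apply, ← lintegral_const_mul' _ _ ENNReal.ofReal_ne_top]
            refine lintegral_congr fun ξ ↦ ?_
            rw [← mul_assoc, ← ENNReal.ofReal_mul (by positivity), Fin.prod_univ_succ]
            simp [mul_comm]
          · have : Measurable fun z : (Fin m → V) × V ↦
                ENNReal.ofReal (‖z.2‖ ^ a) * ‖g.headSlice z.1 z.2‖ₑ ^ 2 :=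
              (by fun_prop : Measurable fun z : (Fin m → V) × V ↦ ENNReal.ofReal (‖z.2‖ ^ a)).mul
                (hslice.enorm.pow_const 2)
            exact this.lintegral_prod_right'

theorem integrable_prod_norm_rpow_mul_multiFourier {a : ℝ} (ha0 : 0 < a) {m : ℕ}
    (f : 𝓢(Fin m → V, ℂ)) :
    Integrable fun ξ ↦ (∏ k, ‖ξ k‖ ^ a) * ‖multiFourier f ξ‖ ^ 2 := by
  obtain ⟨g, hg⟩ := exists_schwartz_eq_multiFourier f
  simp only [← hg]
  obtain ⟨N, hN⟩ := exists_nat_ge a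
  let K := N * m
  let c := 2 ^ K * (Finset.Iic (K, 0)).sup (fun k ↦ SchwartzMap.seminorm ℂ k.1 k.2) g
  have hc (ξ : Fin m → V) : (1 + ‖ξ‖) ^ K * ‖g ξ‖ ≤ c := by
    simpa using SchwartzMap.one_add_le_sup_seminorm_apply (𝕜 := ℂ) (m := (K, 0)) le_rfl le_rfl g ξ
  have hprod (ξ : Fin m → V) : ∏ k, ‖ξ k‖ ^ a ≤ (1 + ‖ξ‖) ^ K := by
    calc ∏ k, ‖ξ k‖ ^ a ≤ ∏ _k : Fin m, (1 + ‖ξ‖) ^ N := by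
          refine Finset.prod_le_prod (fun k _ ↦ by positivity) fun k _ ↦ ?_
          calc ‖ξ k‖ ^ a ≤ (1 + ‖ξ‖) ^ a := by
                gcongr
                linarith [norm_le_pi_norm ξ k]
            _ ≤ (1 + ‖ξ‖) ^ (N : ℝ) :=
                rpow_le_rpow_of_exponent_le (by linarith [norm_nonneg ξ]) hN
            _ = _ := rpow_natCast _ _
      _ = _ := by simp [K, pow_mul]
  refine (g.integrable.norm.const_mul c).mono' ?_ (.of_forall fun ξ ↦ ?_)
  · exact (by fun_prop : Measurable fun ξ : Fin m → V ↦
      (∏ k, ‖ξ k‖ ^ a) * ‖g ξ‖ ^ 2).aestronglyMeasurable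
  · rw [norm_of_nonneg (by positivity)]
    calc (∏ k, ‖ξ k‖ ^ a) * ‖g ξ‖ ^ 2 ≤ (1 + ‖ξ‖) ^ K * ‖g ξ‖ ^ 2 := by
          gcongr
          exact hprod ξ
      _ = ((1 + ‖ξ‖) ^ K * ‖g ξ‖) * ‖g ξ‖ := by ring
      _ ≤ c * ‖g ξ‖ := by
          gcongr
          exact hc ξ

theorem exists_rpow_integral_le_multiFourier {a : ℝ} (ha0 : 0 < a)
    (had : a < Module.finrank ℝ V) (m : ℕ) {q : ℝ}
    (hq : q = Module.finrank ℝ V / (Module.finrank ℝ V - a)) :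
    ∃ c : ℝ, 0 < c ∧ ∀ f : 𝓢(Fin m → V, ℂ),
      (∫ x, ‖f x‖ ^ (2 * q)) ^ q⁻¹ ≤
        c * ∫ ξ, (∏ k, ‖ξ k‖ ^ a) * ‖multiFourier f ξ‖ ^ 2 := by
  have hq0 : 0 < q := hq ▸ div_pos (by linarith) (by linarith)
  obtain ⟨C, hC, h⟩ := exists_lintegral_rpow_le_multiFourier (V := V) ha0 had m
  rw [← hq] at h
  refine ⟨C.toReal ^ q⁻¹ + 1, by positivity, fun f ↦ ?_⟩
  specialize h f
  have hI0 : 0 ≤ ∫ ξ, (∏ k, ‖ξ k‖ ^ a) * ‖multiFourier f ξ‖ ^ 2 :=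
    integral_nonneg fun ξ ↦ by positivity
  have hI : ∫⁻ ξ, ENNReal.ofReal (∏ k, ‖ξ k‖ ^ a) * ‖multiFourier f ξ‖ₑ ^ 2 =
      ENNReal.ofReal (∫ ξ, (∏ k, ‖ξ k‖ ^ a) * ‖multiFourier f ξ‖ ^ 2) := by
    rw [ofReal_integral_eq_lintegral_ofReal (integrable_prod_norm_rpow_mul_multiFourier ha0 f)
      (.of_forall fun ξ ↦ by positivity)]
    refine lintegral_congr fun ξ ↦ ?_
    rw [ENNReal.ofReal_mul (by positivity), ENNReal.ofReal_pow (norm_nonneg _), ofReal_norm]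
  rw [hI, ENNReal.ofReal_rpow_of_nonneg hI0 hq0.le] at h
  have hf : ∫ x, ‖f x‖ ^ (2 * q) = (∫⁻ x, ‖f x‖ₑ ^ (2 * q)).toReal := by
    rw [integral_eq_lintegral_of_nonneg_ae (.of_forall fun x ↦ by positivity)
      (by fun_prop : Measurable fun x ↦ ‖f x‖ ^ (2 * q)).aestronglyMeasurable]
    congr 1
    refine lintegral_congr fun x ↦ ?_
    rw [← ENNReal.ofReal_rpow_of_nonneg (norm_nonneg _) (by positivity), ofReal_norm]
  generalize ∫ ξ, (∏ k, ‖ξ k‖ ^ a) * ‖multiFourier f ξ‖ ^ 2 = I at *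
  have hle := ENNReal.toReal_mono (ENNReal.mul_ne_top hC ENNReal.ofReal_ne_top) h
  rw [← hf, ENNReal.toReal_mul, ENNReal.toReal_ofReal (by positivity)] at hle
  calc (∫ x, ‖f x‖ ^ (2 * q)) ^ q⁻¹ ≤ (C.toReal * I ^ q) ^ q⁻¹ :=
        rpow_le_rpow (integral_nonneg fun x ↦ by positivity) hle (by positivity)
    _ = C.toReal ^ q⁻¹ * I := by
        rw [mul_rpow ENNReal.toReal_nonneg (by positivity), rpow_rpow_inv hI0 hq0.ne']
    _ ≤ _ := by linarith

end Multilinear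

/-- The multilinear Sobolev embedding estimate `‖f‖²_{L^p(ℝ^{mn})} ≤ c Λ₂({α})` of the
paper for uniform exponents `αₖ = α₀`, with `p = 2n/(n-α₀)` and the Fourier transform
normalized by `f̂(ξ) = ∫ e^{2πi ξ·x} f(x) dx`. -/
theorem multilinear_embedding_stmt12 (n m : ℕ) (hn : 1 ≤ n) (hm : 1 ≤ m)
    (α₀ p : ℝ) (hα₀0 : 0 < α₀) (hα₀n : α₀ < (n : ℝ)) (hp : p = 2 * n / ((n : ℝ) - α₀)) :
    ∃ c : ℝ, 0 < c ∧
      ∀ f : SchwartzMap (Fin m → EuclideanSpace ℝ (Fin n)) ℂ,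
        (∫ x : Fin m → EuclideanSpace ℝ (Fin n), ‖f x‖ ^ p) ^ (2 / p)
          ≤ c * ∫ ξ : Fin m → EuclideanSpace ℝ (Fin n),
              (∏ k, ‖ξ k‖ ^ α₀) *
                ‖∫ x : Fin m → EuclideanSpace ℝ (Fin n),
                  Complex.exp (2 * Real.pi * Complex.I * ((∑ k, ⟪ξ k, x k⟫ : ℝ) : ℂ)) *
                    f x‖ ^ 2 := by
  obtain ⟨c, hc, h⟩ := exists_rpow_integral_le_multiFourier
    (V := EuclideanSpace ℝ (Fin n)) hα₀0 (by simpa using hα₀n) m rfl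
  refine ⟨c, hc, fun f ↦ ?_⟩
  have hp2 : p = 2 * (n / (n - α₀)) := by rw [hp, mul_div_assoc]
  have hpq : 2 / p = ((n : ℝ) / (n - α₀))⁻¹ := by
    rw [hp2, ← div_div, div_self two_ne_zero, one_div]
  rw [hpq, hp2]
  simpa only [finrank_euclideanSpace_fin, multiFourier] using h f
end
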